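/- arXiv:1605.05252 — 2 statements merged into one kernel-verified Lean document; each statement's English description precedes it below -/
import Mathlib

section
/- Asymptotics of the extended solution (Lemma 2.1, formula (2.14)): there is a constant C > 0 such that for every real k with |k| ≥ 1 and every r ≥ R₀, |y(r;k) − [j_l(kR) + R·k·j_l'(kR)]·sin(k(ξ(r)−R))/k − R·j_l(kR)·cos(k(ξ(r)−R))| ≤ C/|k|. -/
open scoped Real

/-- The entire extension of `z ↦ sin z / z` (value `1` at `z = 0`). -/
noncomputable def csinc (z : ℂ) : ℂ := if z = 0 then 1 else Complex.sin z / z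

/-- The spherical Bessel function of the first kind of order `l`, via Rayleigh's formula
`j_l(z) = (−z)^l ((1/z)·d/dz)^l (sin z / z)`. -/
noncomputable def sphBessel (l : ℕ) (z : ℂ) : ℂ :=
  (-z) ^ l * ((fun f : ℂ → ℂ => fun w => (1 / w) * deriv f w)^[l] csinc) z

section Oscillator

theorem norm_sub_le_sub_of_norm_hasDerivAt_le {f f' : ℝ → ℂ} {φ φ' : ℝ → ℝ} {a : ℝ}
    (hf : ContinuousOn f (Set.Ici a)) (hφ : ContinuousOn φ (Set.Ici a))
    (hf' : ∀ r, a < r → HasDerivAt f (f' r) r) (hφ' : ∀ r, a < r → HasDerivAt φ (φ' r) r)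
    (hle : ∀ r, a < r → ‖f' r‖ ≤ φ' r) {r : ℝ} (hr : a ≤ r) :
    ‖f r - f a‖ ≤ φ r - φ a := by
  rcases hr.eq_or_lt with rfl | hr
  · simp
  have key : ∀ s ∈ Set.Ioo a r, ‖f r - f s‖ ≤ φ r - φ s := by
    intro s hs
    have hpos : ∀ x, s ≤ x → a < x := fun x hx => hs.1.trans_le hx
    exact image_norm_le_of_norm_deriv_right_le_deriv_boundary' (f := fun x => f x - f s)
      (f' := f') (B := fun x => φ x - φ s) (B' := φ') (a := s) (b := r)
      (fun x hx => ((hf' x (hpos x hx.1)).continuousAt.sub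
        continuousAt_const).continuousWithinAt)
      (fun x hx => ((hf' x (hpos x hx.1)).sub_const _).hasDerivWithinAt)
      (by simp)
      (fun x hx => ((hφ' x (hpos x hx.1)).continuousAt.sub
        continuousAt_const).continuousWithinAt)
      (fun x hx => ((hφ' x (hpos x hx.1)).sub_const _).hasDerivWithinAt)
      (fun x hx => hle x (hpos x hx.1)) (Set.right_mem_Icc.2 hs.2.le)
  have hfa : Filter.Tendsto f (nhdsWithin a (Set.Ioi a)) (nhds (f a)) :=
    (hf a Set.self_mem_Ici).mono_left (nhdsWithin_mono _ Set.Ioi_subset_Ici_self)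
  have hφa : Filter.Tendsto φ (nhdsWithin a (Set.Ioi a)) (nhds (φ a)) :=
    (hφ a Set.self_mem_Ici).mono_left (nhdsWithin_mono _ Set.Ioi_subset_Ici_self)
  refine le_of_tendsto_of_tendsto (hfa.const_sub (f r)).norm (hφa.const_sub (φ r)) ?_
  filter_upwards [Ioo_mem_nhdsGT hr] with s hs using key s hs

variable {R M K k : ℝ} {v w : ℝ → ℂ} {θ σ g : ℝ → ℝ}

/-- Growth bound for a coupled pair whose coupling is dominated by `M / r ^ 2`. -/
theorem norm_sq_add_norm_sq_le_of_coupling {a b a' b' : ℝ → ℂ} (hR : 0 < R)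
    (ha : ContinuousOn a (Set.Ici R)) (hb : ContinuousOn b (Set.Ici R))
    (ha' : ∀ r, R < r → HasDerivAt a (a' r) r) (hb' : ∀ r, R < r → HasDerivAt b (b' r) r)
    (hale : ∀ r, R < r → ‖a' r‖ ≤ M / r ^ 2 * (‖a r‖ + ‖b r‖))
    (hble : ∀ r, R < r → ‖b' r‖ ≤ M / r ^ 2 * (‖a r‖ + ‖b r‖))
    (hM : 0 ≤ M) {r : ℝ} (hr : R ≤ r) :
    ‖a r‖ ^ 2 + ‖b r‖ ^ 2 ≤ (‖a R‖ ^ 2 + ‖b R‖ ^ 2) * Real.exp (4 * M / R) := by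
  let F : ℝ → ℝ := fun r => (‖a r‖ ^ 2 + ‖b r‖ ^ 2) * Real.exp (4 * M / r)
  have hcont : ContinuousOn F (Set.Ici R) := by
    refine ((ha.norm.pow 2).add (hb.norm.pow 2)).mul (Real.continuous_exp.comp_continuousOn ?_)
    exact continuousOn_const.div continuousOn_id fun x hx => (hR.trans_le hx).ne'
  have hder : ∀ x, R < x → HasDerivAt F
      ((2 * inner ℝ (a x) (a' x) + 2 * inner ℝ (b x) (b' x)) * Real.exp (4 * M / x)
        + (‖a x‖ ^ 2 + ‖b x‖ ^ 2) * (Real.exp (4 * M / x) * (4 * M * (-(x ^ 2)⁻¹)))) x := by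
    intro x hx
    have h := ((hasDerivAt_inv (hR.trans hx).ne').const_mul (4 * M)).exp
    exact ((ha' x hx).norm_sq.add (hb' x hx).norm_sq).mul h
  have hanti : AntitoneOn F (Set.Ici R) := by
    refine antitoneOn_of_deriv_nonpos (convex_Ici R) hcont ?_ ?_
    · rw [interior_Ici]
      exact fun x hx => (hder x hx).differentiableAt.differentiableWithinAt
    · rw [interior_Ici]
      intro x hx
      rw [(hder x hx).deriv]
      have h1 := (real_inner_le_norm (a x) (a' x)).trans
        (mul_le_mul_of_nonneg_left (hale x hx) (norm_nonneg _))
      have h2 := (real_inner_le_norm (b x) (b' x)).trans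
        (mul_le_mul_of_nonneg_left (hble x hx) (norm_nonneg _))
      have h3 : 0 ≤ M / x ^ 2 := by positivity
      have h4 : 2 * inner ℝ (a x) (a' x) + 2 * inner ℝ (b x) (b' x)
          - (‖a x‖ ^ 2 + ‖b x‖ ^ 2) * (4 * (M / x ^ 2)) ≤ 0 := by
        nlinarith [mul_nonneg h3 (sq_nonneg (‖a x‖ - ‖b x‖))]
      have h5 := mul_nonpos_of_nonpos_of_nonneg h4 (Real.exp_pos (4 * M / x)).le
      calc _ = _ := by ring
        _ ≤ 0 := h5
  calc ‖a r‖ ^ 2 + ‖b r‖ ^ 2 ≤ F r :=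
        le_mul_of_one_le_right (by positivity)
          (Real.one_le_exp (div_nonneg (by positivity) (hR.trans_le hr).le))
    _ ≤ F R := hanti Set.self_mem_Ici hr hr

/-- A solution of the oscillator `v' = σ w`, `w' = -k² σ v + g v` with perturbation `g` dominated
by `M / r ^ 2` agrees with the unperturbed solution up to `O(1 / |k|)`. -/
theorem norm_sub_unperturbed_oscillator_le (hR : 0 < R) (hM : 0 ≤ M) (hk : 1 ≤ |k|)
    (hv : ContinuousOn v (Set.Ici R)) (hw : ContinuousOn w (Set.Ici R))
    (hθ : ContinuousOn θ (Set.Ici R)) (hθR : θ R = 0)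
    (hv' : ∀ r, R < r → HasDerivAt v (σ r * w r) r)
    (hw' : ∀ r, R < r → HasDerivAt w (-k ^ 2 * σ r * v r + g r * v r) r)
    (hθ' : ∀ r, R < r → HasDerivAt θ (σ r) r)
    (hg : ∀ r, R < r → |g r| ≤ M / r ^ 2)
    (hK : 0 ≤ K) (hvR : ‖v R‖ ≤ K) (hwR : ‖w R‖ ≤ K * |k|) {r : ℝ} (hr : R ≤ r) :
    ‖v r - w R * Complex.sin (k * θ r) / k - v R * Complex.cos (k * θ r)‖
      ≤ 2 * (M * (2 * K * Real.exp (2 * M / R))) / R / |k| := by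
  have hkpos : 0 < |k| := one_pos.trans_le hk
  have hk0 : k ≠ 0 := abs_pos.1 hkpos
  have hkC : (k : ℂ) ≠ 0 := by exact_mod_cast hk0
  let c : ℝ → ℝ := fun r => Real.cos (k * θ r)
  let s : ℝ → ℝ := fun r => Real.sin (k * θ r)
  let a : ℝ → ℂ := fun r => v r * c r - w r / k * s r
  let b : ℝ → ℂ := fun r => v r * s r + w r / k * c r
  have hcs : ∀ r, (c r : ℂ) ^ 2 + (s r : ℂ) ^ 2 = 1 := fun r => by
    exact_mod_cast Real.cos_sq_add_sin_sq (k * θ r)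
  have hcn : ∀ r, ‖(c r : ℂ)‖ ≤ 1 := fun r => by
    rw [Complex.norm_real]; exact Real.abs_cos_le_one _
  have hsn : ∀ r, ‖(s r : ℂ)‖ ≤ 1 := fun r => by
    rw [Complex.norm_real]; exact Real.abs_sin_le_one _
  have hvab : ∀ r, v r = a r * c r + b r * s r := fun r => by
    simp only [a, b]; linear_combination (-v r) * hcs r
  have hcd : ∀ r, R < r → HasDerivAt (fun x => (c x : ℂ)) (-(s r) * (k * σ r) : ℂ) r := by
    intro r hr
    have := ((hθ' r hr).const_mul k).cos.ofReal_comp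
    simpa [c, s] using this
  have hsd : ∀ r, R < r → HasDerivAt (fun x => (s x : ℂ)) ((c r) * (k * σ r) : ℂ) r := by
    intro r hr
    have := ((hθ' r hr).const_mul k).sin.ofReal_comp
    simpa [c, s] using this
  have had : ∀ r, R < r → HasDerivAt a (-(g r / k * v r * s r)) r := by
    intro r hr
    refine (((hv' r hr).mul (hcd r hr)).sub (((hw' r hr).div_const (k : ℂ)).mul
      (hsd r hr))).congr_deriv ?_
    field_simp
    ring
  have hbd : ∀ r, R < r → HasDerivAt b (g r / k * v r * c r) r := by
    intro r hr
    refine (((hv' r hr).mul (hsd r hr)).add (((hw' r hr).div_const (k : ℂ)).mul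
      (hcd r hr))).congr_deriv ?_
    field_simp
    ring
  have hcc : ContinuousOn (fun x => (c x : ℂ)) (Set.Ici R) :=
    Complex.continuous_ofReal.comp_continuousOn
      (Real.continuous_cos.comp_continuousOn (continuousOn_const.mul hθ))
  have hsc : ContinuousOn (fun x => (s x : ℂ)) (Set.Ici R) :=
    Complex.continuous_ofReal.comp_continuousOn
      (Real.continuous_sin.comp_continuousOn (continuousOn_const.mul hθ))
  have hac : ContinuousOn a (Set.Ici R) := (hv.mul hcc).sub ((hw.div_const _).mul hsc)
  have hbc : ContinuousOn b (Set.Ici R) := (hv.mul hsc).add ((hw.div_const _).mul hcc)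
  have hvle : ∀ r, ‖v r‖ ≤ ‖a r‖ + ‖b r‖ := fun r => by
    rw [hvab r]
    refine (norm_add_le _ _).trans ?_
    rw [norm_mul, norm_mul]
    exact add_le_add (mul_le_of_le_one_right (norm_nonneg _) (hcn r))
      (mul_le_of_le_one_right (norm_nonneg _) (hsn r))
  have hforce : ∀ (r : ℝ) (t : ℂ), R < r → ‖t‖ ≤ 1 →
      ‖(g r / k * v r * t : ℂ)‖ ≤ M / r ^ 2 / |k| * ‖v r‖ := by
    intro r t hr ht
    rw [norm_mul, norm_mul, norm_div, Complex.norm_real, Complex.norm_real, Real.norm_eq_abs,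
      Real.norm_eq_abs]
    refine (mul_le_of_le_one_right (by positivity) ht).trans ?_
    gcongr
    exact hg r hr
  have hforce' : ∀ (r : ℝ) (t : ℂ), R < r → ‖t‖ ≤ 1 →
      ‖(g r / k * v r * t : ℂ)‖ ≤ M / r ^ 2 * (‖a r‖ + ‖b r‖) := by
    intro r t hr ht
    refine (hforce r t hr ht).trans ?_
    exact mul_le_mul (div_le_self (by positivity) hk) (hvle r) (norm_nonneg _) (by positivity)
  have haR : a R = v R := by simp [a, c, s, hθR]
  have hbR : b R = w R / k := by simp [b, c, s, hθR]
  have hbRn : ‖b R‖ ≤ K := by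
    rw [hbR, norm_div, Complex.norm_real, Real.norm_eq_abs]
    exact div_le_of_le_mul₀ hkpos.le hK hwR
  set V : ℝ := 2 * K * Real.exp (2 * M / R) with hV
  have hV0 : 0 ≤ V := by positivity
  have hvV : ∀ r, R ≤ r → ‖v r‖ ≤ V := by
    intro r hr
    have hE := norm_sq_add_norm_sq_le_of_coupling hR hac hbc had hbd
      (fun r hr => by rw [norm_neg]; exact hforce' r _ hr (hsn r))
      (fun r hr => hforce' r _ hr (hcn r)) hM hr
    refine abs_le_of_sq_le_sq' ?_ hV0 |>.2
    have h1 : ‖a R‖ ^ 2 + ‖b R‖ ^ 2 ≤ 2 * K ^ 2 := by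
      rw [haR]
      have := pow_le_pow_left₀ (norm_nonneg _) hvR 2
      have := pow_le_pow_left₀ (norm_nonneg _) hbRn 2
      linarith
    have h2 : Real.exp (4 * M / R) = Real.exp (2 * M / R) ^ 2 := by
      rw [← Real.exp_nat_mul]; congr 1; push_cast; ring
    have h3 := hE.trans (mul_le_mul_of_nonneg_right h1 (Real.exp_pos _).le)
    have h4 := pow_le_pow_left₀ (norm_nonneg _) (hvle r) 2
    rw [h2] at h3
    rw [hV]
    nlinarith [sq_nonneg (‖a r‖ - ‖b r‖)]
  let φ : ℝ → ℝ := fun r => -(M * V / |k|) * r⁻¹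
  have hφ : ∀ r, R < r → HasDerivAt φ (-(M * V / |k|) * (-(r ^ 2)⁻¹)) r := fun r hr =>
    (hasDerivAt_inv (hR.trans hr).ne').const_mul _
  have hφc : ContinuousOn φ (Set.Ici R) :=
    continuousOn_const.mul (continuousOn_id.inv₀ fun x hx => (hR.trans_le hx).ne')
  have hφle : φ r - φ R ≤ M * V / R / |k| := by
    have : 0 ≤ M * V / |k| * r⁻¹ := by
      have := hR.trans_le hr
      positivity
    calc φ r - φ R = M * V / R / |k| - M * V / |k| * r⁻¹ := by simp only [φ]; ring
      _ ≤ _ := by linarith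
  have hbound : ∀ (r : ℝ) (t : ℂ), R < r → ‖t‖ ≤ 1 →
      ‖(g r / k * v r * t : ℂ)‖ ≤ -(M * V / |k|) * (-(r ^ 2)⁻¹) := by
    intro r t hr ht
    refine (hforce r t hr ht).trans ?_
    calc M / r ^ 2 / |k| * ‖v r‖ ≤ M / r ^ 2 / |k| * V := by
          gcongr; exact hvV r hr.le
      _ = _ := by ring
  have hA := (norm_sub_le_sub_of_norm_hasDerivAt_le hac hφc had hφ
    (fun r hr => by rw [norm_neg]; exact hbound r _ hr (hsn r)) hr).trans hφle
  have hB := (norm_sub_le_sub_of_norm_hasDerivAt_le hbc hφc hbd hφ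
    (fun r hr => hbound r _ hr (hcn r)) hr).trans hφle
  have herr : v r - w R * Complex.sin (k * θ r) / k - v R * Complex.cos (k * θ r)
      = (a r - a R) * c r + (b r - b R) * s r := by
    have h1 : Complex.sin (k * θ r) = s r := by simp [s]
    have h2 : Complex.cos (k * θ r) = c r := by simp [c]
    rw [h1, h2, haR, hbR, hvab r]
    ring
  rw [herr]
  calc _ ≤ ‖(a r - a R) * c r‖ + ‖(b r - b R) * s r‖ := norm_add_le _ _
    _ ≤ ‖a r - a R‖ + ‖b r - b R‖ := by
        rw [norm_mul, norm_mul]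
        exact add_le_add (mul_le_of_le_one_right (norm_nonneg _) (hcn r))
          (mul_le_of_le_one_right (norm_nonneg _) (hsn r))
    _ ≤ M * V / R / |k| + M * V / R / |k| := add_le_add hA hB
    _ = _ := by ring

end Oscillator

section SphericalBessel

/-- The iterates `((1/z)·d/dz)^l (sin z / z)`. -/
noncomputable def rayleighIter (l : ℕ) : ℂ → ℂ :=
  (fun f : ℂ → ℂ => fun w => (1 / w) * deriv f w)^[l] csinc

theorem rayleighIter_succ (l : ℕ) (z : ℂ) :
    rayleighIter (l + 1) z = 1 / z * deriv (rayleighIter l) z := by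
  simp only [rayleighIter, Function.iterate_succ_apply']

theorem sphBessel_eq (l : ℕ) : sphBessel l = fun z => (-z) ^ l * rayleighIter l z := rfl

theorem rayleighIter_zero {z : ℂ} (hz : z ≠ 0) : rayleighIter 0 z = Complex.sin z / z := by
  simp [rayleighIter, csinc, hz]

theorem differentiableAt_rayleighIter (l : ℕ) {z : ℂ} (hz : z ≠ 0) :
    DifferentiableAt ℂ (rayleighIter l) z := by
  suffices h : DifferentiableOn ℂ (rayleighIter l) {0}ᶜ from
    h.differentiableAt (isOpen_compl_singleton.mem_nhds hz)
  induction l with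
  | zero =>
    refine DifferentiableOn.congr (f := fun z => Complex.sin z / z) ?_
      fun z hz => rayleighIter_zero hz
    exact Complex.differentiable_sin.differentiableOn.div differentiableOn_id fun z hz => hz
  | succ l ih =>
    refine DifferentiableOn.congr (f := fun z => 1 / z * deriv (rayleighIter l) z) ?_
      fun z _ => rayleighIter_succ l z
    exact ((differentiableOn_const 1).div differentiableOn_id fun z hz => hz).mul
      (ih.deriv isOpen_compl_singleton)

theorem hasDerivAt_rayleighIter (l : ℕ) {z : ℂ} (hz : z ≠ 0) :
    HasDerivAt (rayleighIter l) (z * rayleighIter (l + 1) z) z := by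
  have h : z * rayleighIter (l + 1) z = deriv (rayleighIter l) z := by
    rw [rayleighIter_succ]; field_simp
  rw [h]
  exact (differentiableAt_rayleighIter l hz).hasDerivAt

theorem rayleighIter_succ_eq_of_hasDerivAt {l : ℕ} {z d : ℂ} {f : ℂ → ℂ} (hz : z ≠ 0)
    (hf : ∀ w, w ≠ 0 → rayleighIter l w = f w) (hd : HasDerivAt f d z) :
    rayleighIter (l + 1) z = d / z := by
  have h : rayleighIter l =ᶠ[nhds z] f := by
    filter_upwards [isOpen_compl_singleton.mem_nhds hz] with w hw using hf w hw
  have := (hasDerivAt_rayleighIter l hz).unique (hd.congr_of_eventuallyEq h)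
  rw [← this]; field_simp

theorem exists_polynomial_rayleighIter (l : ℕ) : ∃ P Q : Polynomial ℂ, ∀ z : ℂ, z ≠ 0 →
    rayleighIter l z
      = z⁻¹ ^ (l + 1) * (P.eval z⁻¹ * Complex.sin z + Q.eval z⁻¹ * Complex.cos z) := by
  induction l with
  | zero =>
    refine ⟨1, 0, fun z hz => ?_⟩
    rw [rayleighIter_zero hz]; simp; ring
  | succ l ih =>
    obtain ⟨P, Q, h⟩ := ih
    refine ⟨-(Polynomial.C (l + 1 : ℂ)) * Polynomial.X * P
        - Polynomial.X ^ 2 * Polynomial.derivative P - Q,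
      -(Polynomial.C (l + 1 : ℂ)) * Polynomial.X * Q
        - Polynomial.X ^ 2 * Polynomial.derivative Q + P, fun z hz => ?_⟩
    have hi := hasDerivAt_inv hz
    have hP := (P.hasDerivAt z⁻¹).comp z hi
    have hQ := (Q.hasDerivAt z⁻¹).comp z hi
    have hd := (hi.pow (l + 1)).mul
      ((hP.mul (Complex.hasDerivAt_sin z)).add (hQ.mul (Complex.hasDerivAt_cos z)))
    rw [rayleighIter_succ_eq_of_hasDerivAt hz h hd]
    simp only [Polynomial.eval_sub, Polynomial.eval_add, Polynomial.eval_mul, Polynomial.eval_neg,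
      Polynomial.eval_C, Polynomial.eval_X, Polynomial.eval_pow, Function.comp_apply,
      Nat.add_sub_cancel, Nat.cast_add, Nat.cast_one, Pi.add_apply, Pi.mul_apply, Pi.pow_apply,
      div_eq_mul_inv, ← inv_pow]
    ring

theorem rayleighIter_recurrence (l : ℕ) {z : ℂ} (hz : z ≠ 0) :
    z ^ 2 * rayleighIter (l + 2) z + (2 * l + 3) * rayleighIter (l + 1) z + rayleighIter l z
      = 0 := by
  induction l generalizing z with
  | zero =>
    have h1 : ∀ w : ℂ, w ≠ 0 →
        rayleighIter 1 w = (Complex.cos w * w - Complex.sin w * 1) / w ^ 2 / w := fun w hw =>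
      rayleighIter_succ_eq_of_hasDerivAt hw (fun _ => rayleighIter_zero)
        ((Complex.hasDerivAt_sin w).div (hasDerivAt_id w) hw)
    have hd := ((((Complex.hasDerivAt_cos z).mul (hasDerivAt_id z)).sub
      ((Complex.hasDerivAt_sin z).mul_const 1)).div (hasDerivAt_pow 2 z) (pow_ne_zero 2 hz)).div
        (hasDerivAt_id z) hz
    have h2 := rayleighIter_succ_eq_of_hasDerivAt hz h1 hd
    simp only [zero_add, Nat.reduceAdd] at h2 ⊢
    rw [h2, h1 z hz, rayleighIter_zero hz]
    simp
    field_simp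
    ring
  | succ l ih =>
    have hd := (((hasDerivAt_pow 2 z).mul (hasDerivAt_rayleighIter (l + 2) hz)).add
      ((hasDerivAt_rayleighIter (l + 1) hz).const_mul (2 * l + 3 : ℂ))).add
        (hasDerivAt_rayleighIter l hz)
    have h0 : HasDerivAt (fun _ : ℂ => (0 : ℂ)) 0 z := hasDerivAt_const z 0
    have heq := hd.unique (h0.congr_of_eventuallyEq (by
      filter_upwards [isOpen_compl_singleton.mem_nhds hz] with w hw using ih hw))
    apply mul_left_cancel₀ hz
    push_cast
    simp only [Nat.cast_ofNat] at heq
    linear_combination heq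

theorem rayleighIter_ne_zero_or (l : ℕ) {z : ℂ} (hz : z ≠ 0) :
    rayleighIter l z ≠ 0 ∨ rayleighIter (l + 1) z ≠ 0 := by
  induction l with
  | zero =>
    by_contra! h
    have h1 := rayleighIter_succ_eq_of_hasDerivAt hz (fun _ => rayleighIter_zero)
        ((Complex.hasDerivAt_sin z).div (hasDerivAt_id z) hz)
    rw [rayleighIter_zero hz] at h
    have hs : Complex.sin z = 0 := by simpa [hz] using h.1
    have hc : Complex.cos z = 0 := by
      rw [h1] at h; simpa [hz, hs] using h.2
    simpa [hs, hc] using Complex.sin_sq_add_cos_sq z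
  | succ l ih =>
    by_contra! h
    have := rayleighIter_recurrence l hz
    rw [h.1, h.2] at this
    simp_all

theorem deriv_sphBessel (l : ℕ) {z : ℂ} (hz : z ≠ 0) :
    deriv (sphBessel l) z = l / z * sphBessel l z - sphBessel (l + 1) z := by
  have h := ((hasDerivAt_neg z).pow l).mul (hasDerivAt_rayleighIter l hz)
  have h' : deriv (sphBessel l) z = _ := h.deriv
  rw [h', sphBessel_eq, sphBessel_eq]
  cases l with
  | zero => simp
  | succ l =>
    simp
    field_simp
    ring

/-- A spherical Bessel function has only simple zeros away from the origin. -/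
theorem deriv_sphBessel_ne_zero {l : ℕ} {z : ℂ} (hz : z ≠ 0) (h : sphBessel l z = 0) :
    deriv (sphBessel l) z ≠ 0 := by
  rw [deriv_sphBessel l hz, h, mul_zero, zero_sub, neg_ne_zero]
  have hn : -z ≠ 0 := neg_ne_zero.2 hz
  have hl : rayleighIter l z = 0 := by
    rw [sphBessel_eq] at h
    exact (mul_eq_zero.1 h).resolve_left (pow_ne_zero l hn)
  rw [sphBessel_eq]
  exact mul_ne_zero (pow_ne_zero _ hn) ((rayleighIter_ne_zero_or l hz).resolve_left (not_not.2 hl))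

theorem exists_norm_sphBessel_le (l : ℕ) {R : ℝ} (hR : 0 < R) :
    ∃ C : ℝ, 0 ≤ C ∧ ∀ x : ℝ, R ≤ |x| → ‖sphBessel l x‖ ≤ C := by
  obtain ⟨P, Q, h⟩ := exists_polynomial_rayleighIter l
  have hcpt := isCompact_closedBall (0 : ℂ) R⁻¹
  obtain ⟨p, hp⟩ := hcpt.exists_bound_of_continuousOn P.continuous.continuousOn
  obtain ⟨q, hq⟩ := hcpt.exists_bound_of_continuousOn Q.continuous.continuousOn
  have h0 : (0 : ℂ) ∈ Metric.closedBall (0 : ℂ) R⁻¹ := by simpa using hR.le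
  have hp0 : 0 ≤ p := (norm_nonneg _).trans (hp 0 h0)
  have hq0 : 0 ≤ q := (norm_nonneg _).trans (hq 0 h0)
  refine ⟨R⁻¹ * (p + q), by positivity, fun x hx => ?_⟩
  have hx0 : x ≠ 0 := abs_pos.1 (hR.trans_le hx)
  have hxC : (x : ℂ) ≠ 0 := by exact_mod_cast hx0
  have hinv : ‖(x : ℂ)⁻¹‖ ≤ R⁻¹ := by
    rw [norm_inv, Complex.norm_real, Real.norm_eq_abs]
    exact inv_anti₀ hR hx
  have hmem : (x : ℂ)⁻¹ ∈ Metric.closedBall (0 : ℂ) R⁻¹ := by simpa using hinv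
  have hs : ‖Complex.sin x‖ ≤ 1 := by
    rw [← Complex.ofReal_sin, Complex.norm_real]; exact Real.abs_sin_le_one x
  have hc : ‖Complex.cos x‖ ≤ 1 := by
    rw [← Complex.ofReal_cos, Complex.norm_real]; exact Real.abs_cos_le_one x
  have heq : sphBessel l x = (-1) ^ l * ((x : ℂ)⁻¹ *
      (P.eval (x : ℂ)⁻¹ * Complex.sin x + Q.eval (x : ℂ)⁻¹ * Complex.cos x)) := by
    rw [sphBessel_eq]
    simp only [h x hxC, neg_pow (x : ℂ) l, pow_succ, inv_pow]
    field_simp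
  rw [heq, norm_mul, norm_pow, norm_neg, norm_one, one_pow, one_mul, norm_mul]
  gcongr
  refine (norm_add_le _ _).trans ?_
  rw [norm_mul, norm_mul]
  gcongr
  · exact (mul_le_of_le_one_right (norm_nonneg _) hs).trans (hp _ hmem)
  · exact (mul_le_of_le_one_right (norm_nonneg _) hc).trans (hq _ hmem)

theorem exists_norm_deriv_sphBessel_le (l : ℕ) {R : ℝ} (hR : 0 < R) :
    ∃ C : ℝ, 0 ≤ C ∧ ∀ x : ℝ, R ≤ |x| → ‖deriv (sphBessel l) x‖ ≤ C := by
  obtain ⟨C, hC, h⟩ := exists_norm_sphBessel_le l hR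
  obtain ⟨D, hD, h'⟩ := exists_norm_sphBessel_le (l + 1) hR
  refine ⟨l / R * C + D, by positivity, fun x hx => ?_⟩
  have hx0 : (x : ℂ) ≠ 0 := by exact_mod_cast abs_pos.1 (hR.trans_le hx)
  rw [deriv_sphBessel l hx0]
  refine (norm_sub_le _ _).trans ?_
  rw [norm_mul, norm_div, Complex.norm_natCast, Complex.norm_real, Real.norm_eq_abs]
  gcongr
  · exact h x hx
  · exact h' x hx

end SphericalBessel

section LiouvilleTransform

/-- The perturbation produced by the Liouville transform with `p = n ^ (1 / 4)`. -/
noncomputable def liouvillePotential (p : ℝ → ℝ) (L r : ℝ) : ℝ :=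
  (deriv (deriv p) r / p r ^ 2 - 2 * deriv p r ^ 2 / p r ^ 3 + L / (r ^ 2 * p r)) / p r

theorem exists_abs_liouvillePotential_le {p : ℝ → ℝ} {R R₀ L : ℝ} (hR : 0 < R) (hRR₀ : R < R₀)
    (hL : 0 ≤ L) (hp : ContDiffOn ℝ 2 p (Set.Ioi 0)) (hpos : ∀ r, 0 < r → 0 < p r)
    (hpout : ∀ r, R₀ ≤ r → p r = 1) :
    ∃ M : ℝ, 0 ≤ M ∧ ∀ r, R < r → |liouvillePotential p L r| ≤ M / r ^ 2 := by
  have h1 : ContDiffOn ℝ 1 (deriv p) (Set.Ioi 0) := hp.deriv_of_isOpen isOpen_Ioi (by norm_num)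
  have h2 : ContinuousOn (deriv (deriv p)) (Set.Ioi 0) :=
    h1.continuousOn_deriv_of_isOpen isOpen_Ioi le_rfl
  have hc : ContinuousOn (liouvillePotential p L) (Set.Ioi 0) := by
    have hpc := hp.continuousOn
    have hne : ∀ r ∈ Set.Ioi (0 : ℝ), p r ≠ 0 := fun r hr => (hpos r hr).ne'
    refine ((((h2.div (hpc.pow 2) fun r hr => pow_ne_zero 2 (hne r hr)).sub
      ((continuousOn_const.mul (h1.continuousOn.pow 2)).div (hpc.pow 3)
        fun r hr => pow_ne_zero 3 (hne r hr))).add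
      (continuousOn_const.div ((continuousOn_id.pow 2).mul hpc)
        fun r hr => mul_ne_zero (pow_ne_zero 2 (ne_of_gt hr)) (hne r hr))).div hpc hne)
  obtain ⟨B, hB⟩ := (isCompact_Icc (a := R) (b := R₀)).exists_bound_of_continuousOn
    (hc.mono fun r hr => hR.trans_le hr.1)
  have hB0 : 0 ≤ B := (norm_nonneg _).trans (hB R (Set.left_mem_Icc.2 hRR₀.le))
  refine ⟨B * R₀ ^ 2 + L, by positivity, fun r hr => ?_⟩
  have hr0 : 0 < r := hR.trans hr
  rw [le_div_iff₀ (by positivity)]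
  rcases le_or_gt r R₀ with hr' | hr'
  · have h := hB r ⟨hr.le, hr'⟩
    rw [Real.norm_eq_abs] at h
    have : r ^ 2 ≤ R₀ ^ 2 := pow_le_pow_left₀ hr0.le hr' 2
    have := mul_le_mul h this (by positivity) hB0
    linarith
  · have hloc : ∀ x, R₀ < x → deriv p x = 0 := fun x hx => by
      have : p =ᶠ[nhds x] fun _ => 1 := by
        filter_upwards [Ioi_mem_nhds hx] with u hu using hpout u (le_of_lt hu)
      rw [this.deriv_eq, deriv_const]
    have hloc' : deriv (deriv p) r = 0 := by
      have : deriv p =ᶠ[nhds r] fun _ => 0 := by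
        filter_upwards [Ioi_mem_nhds hr'] with u hu using hloc u hu
      rw [this.deriv_eq, deriv_const]
    have : liouvillePotential p L r * r ^ 2 = L := by
      rw [liouvillePotential, hloc', hloc r hr', hpout r hr'.le]
      field_simp
      simp
    rw [← abs_of_pos (show 0 < r ^ 2 by positivity), ← abs_mul, this, abs_of_nonneg hL]
    have : 0 ≤ B * R₀ ^ 2 := by positivity
    linarith

/-- The Liouville transform turns the radial equation with index `p ^ 4` into a perturbed
oscillator. -/
theorem hasDerivAt_liouville {p : ℝ → ℝ} {y yd : ℝ → ℂ} {y2 : ℂ} {k L r : ℝ}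
    (hr : 0 < r) (hp0 : 0 < p r)
    (hp : HasDerivAt p (deriv p r) r) (hp' : HasDerivAt (deriv p) (deriv (deriv p) r) r)
    (hy : HasDerivAt y (yd r) r) (hyd : HasDerivAt yd y2 r)
    (hode : y2 + ((k : ℂ) ^ 2 * ((p r ^ 4 : ℝ) : ℂ) - (L : ℂ) / (r : ℂ) ^ 2) * y r = 0) :
    HasDerivAt (fun x => (p x : ℂ) * y x)
        (((p r ^ 2 : ℝ) : ℂ) * (((deriv p r : ℝ) : ℂ) * y r / (p r : ℂ) ^ 2 + yd r / p r)) r ∧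
      HasDerivAt (fun x => ((deriv p x : ℝ) : ℂ) * y x / (p x : ℂ) ^ 2 + yd x / p x)
        (-(k : ℂ) ^ 2 * ((p r ^ 2 : ℝ) : ℂ) * (p r * y r)
          + (liouvillePotential p L r : ℂ) * (p r * y r)) r := by
  have hpC : (p r : ℂ) ≠ 0 := by exact_mod_cast hp0.ne'
  have hrC : (r : ℂ) ≠ 0 := by exact_mod_cast hr.ne'
  have hq := hp.ofReal_comp
  have hq' := hp'.ofReal_comp
  have hy2 : y2 = -(((k : ℂ) ^ 2 * (p r : ℂ) ^ 4 - (L : ℂ) / (r : ℂ) ^ 2) * y r) := by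
    push_cast at hode
    linear_combination hode
  constructor
  · refine (hq.mul hy).congr_deriv ?_
    push_cast
    field_simp
  · refine (((hq'.mul hy).div (hq.pow 2) (pow_ne_zero 2 hpC)).add
      (hyd.div hq hpC)).congr_deriv ?_
    rw [hy2, liouvillePotential]
    simp
    field_simp
    ring

end LiouvilleTransform

section OneSidedDerivative

variable {f : ℝ → ℂ} {R : ℝ}

theorem hasDerivAt_derivWithin_Ici (hf : ContDiffOn ℝ 2 f (Set.Ici R)) {r : ℝ} (hr : R < r) :
    HasDerivAt f (derivWithin f (Set.Ici R) r) r :=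
  ((hf.differentiableOn (by norm_num)) r hr.le).hasDerivWithinAt.hasDerivAt (Ici_mem_nhds hr)

theorem hasDerivAt_derivWithin_Ici_deriv_deriv (hf : ContDiffOn ℝ 2 f (Set.Ici R)) {r : ℝ}
    (hr : R < r) : HasDerivAt (derivWithin f (Set.Ici R)) (deriv (deriv f) r) r := by
  have h1 : ContDiffOn ℝ 1 (derivWithin f (Set.Ici R)) (Set.Ici R) :=
    hf.derivWithin (uniqueDiffOn_Ici R) (by norm_num)
  have h2 := ((h1.differentiableOn (by norm_num)) r hr.le).differentiableAt (Ici_mem_nhds hr)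
  have h3 : deriv f =ᶠ[nhds r] derivWithin f (Set.Ici R) := by
    filter_upwards [Ioi_mem_nhds hr] with x hx using (hasDerivAt_derivWithin_Ici hf hx).deriv
  rw [h3.deriv_eq]
  exact h2.hasDerivAt

/-- The two-sided and the one-sided derivative at the end point agree, unless both the first and
the second two-sided derivative take junk values there. -/
theorem derivWithin_Ici_eq_deriv_or (hf : ContDiffOn ℝ 2 f (Set.Ici R)) :
    derivWithin f (Set.Ici R) R = deriv f R ∨ (deriv f R = 0 ∧ deriv (deriv f) R = 0) := by
  by_cases hd : DifferentiableAt ℝ f R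
  · exact .inl (hd.derivWithin (uniqueDiffOn_Ici R R Set.self_mem_Ici))
  by_cases hd' : DifferentiableAt ℝ (deriv f) R
  · left
    have h1 : ContDiffOn ℝ 1 (derivWithin f (Set.Ici R)) (Set.Ici R) :=
      hf.derivWithin (uniqueDiffOn_Ici R) (by norm_num)
    have ht : Filter.Tendsto (derivWithin f (Set.Ici R)) (nhdsWithin R (Set.Ioi R))
        (nhds (derivWithin f (Set.Ici R) R)) :=
      (h1.continuousOn R Set.self_mem_Ici).mono_left (nhdsWithin_mono _ Set.Ioi_subset_Ici_self)
    have ht' : Filter.Tendsto (deriv f) (nhdsWithin R (Set.Ioi R)) (nhds (deriv f R)) :=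
      hd'.continuousAt.mono_left nhdsWithin_le_nhds
    refine tendsto_nhds_unique ht (ht'.congr' ?_)
    filter_upwards [self_mem_nhdsWithin] with x hx using (hasDerivAt_derivWithin_Ici hf hx).deriv
  · exact .inr ⟨deriv_zero_of_not_differentiableAt hd, deriv_zero_of_not_differentiableAt hd'⟩

end OneSidedDerivative

/-- Asymptotics of a radial solution in terms of its one-sided initial data at `R`. -/
theorem exists_norm_sub_radial_asymptotics_le
    {R R₀ L : ℝ} (hR : 0 < R) (hRR₀ : R < R₀) (hL : 0 ≤ L)
    {n : ℝ → ℝ} (hn : ContDiffOn ℝ 2 n (Set.Ici 0))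
    (hnpos : ∀ r ∈ Set.Ici (0:ℝ), 0 < n r)
    (hnin : ∀ r ∈ Set.Icc (0:ℝ) R, n r = 1) (hnout : ∀ r ∈ Set.Ici R₀, n r = 1)
    {ξ : ℝ → ℝ} (hξ : ∀ r : ℝ, ξ r = ∫ ρ in (0:ℝ)..r, Real.sqrt (n ρ)) :
    ∃ D : ℝ, 0 ≤ D ∧ ∀ (k K : ℝ) (y : ℝ → ℂ), 1 ≤ |k| → 0 ≤ K →
      ContDiffOn ℝ 2 y (Set.Ici R) →
      (∀ r ∈ Set.Ici R, deriv (deriv y) r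
        + ((k : ℂ) ^ 2 * (n r : ℂ) - (L : ℂ) / (r : ℂ) ^ 2) * y r = 0) →
      ‖y R‖ ≤ K → ‖derivWithin y (Set.Ici R) R‖ ≤ K * |k| → ∀ r, R₀ ≤ r →
      ‖y r - derivWithin y (Set.Ici R) R * Complex.sin (k * ((ξ r - R : ℝ) : ℂ)) / k
        - y R * Complex.cos (k * ((ξ r - R : ℝ) : ℂ))‖ ≤ D * K / |k| := by
  let p : ℝ → ℝ := fun r => √(√(n r))
  have hpos : ∀ r, 0 ≤ r → 0 < p r := fun r hr => Real.sqrt_pos.2 (Real.sqrt_pos.2 (hnpos r hr))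
  have hp2 : ∀ r, p r ^ 2 = √(n r) := fun r => Real.sq_sqrt (Real.sqrt_nonneg _)
  have hp4 : ∀ r, 0 ≤ r → p r ^ 4 = n r := fun r hr => by
    rw [show 4 = 2 * 2 from rfl, pow_mul, hp2, Real.sq_sqrt (hnpos r hr).le]
  have hp : ContDiffOn ℝ 2 p (Set.Ioi 0) :=
    ((hn.sqrt fun r hr => (hnpos r hr).ne').sqrt
      fun r hr => (Real.sqrt_pos.2 (hnpos r hr)).ne').mono Set.Ioi_subset_Ici_self
  have hpin : ∀ r ∈ Set.Icc 0 R, p r = 1 := fun r hr => by simp [p, hnin r hr]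
  have hpout : ∀ r, R₀ ≤ r → p r = 1 := fun r hr => by simp [p, hnout r hr]
  have hp' : ContDiffOn ℝ 1 (deriv p) (Set.Ioi 0) := hp.deriv_of_isOpen isOpen_Ioi (by norm_num)
  have hpd : ∀ r, 0 < r → HasDerivAt p (deriv p r) r := fun r hr =>
    ((hp.differentiableOn (by norm_num)).differentiableAt (Ioi_mem_nhds hr)).hasDerivAt
  have hpd' : ∀ r, 0 < r → HasDerivAt (deriv p) (deriv (deriv p) r) r := fun r hr =>
    ((hp'.differentiableOn (by norm_num)).differentiableAt (Ioi_mem_nhds hr)).hasDerivAt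
  have hpR : p R = 1 := hpin R ⟨hR.le, le_rfl⟩
  have hpdR : deriv p R = 0 := by
    have h1 : HasDerivWithinAt p (deriv p R) (Set.Icc 0 R) R := (hpd R hR).hasDerivWithinAt
    have h2 : HasDerivWithinAt p 0 (Set.Icc 0 R) R :=
      (hasDerivWithinAt_const R _ (1 : ℝ)).congr hpin hpR
    exact (uniqueDiffOn_Icc hR R ⟨hR.le, le_rfl⟩).eq_deriv _ h1 h2
  have hcs : ContinuousOn (fun r => √(n r)) (Set.Ici 0) := hn.continuousOn.sqrt
  have hξd : ∀ r, 0 < r → HasDerivAt ξ (√(n r)) r := by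
    intro r hr
    rw [funext hξ]
    refine intervalIntegral.integral_hasDerivAt_right ?_ ?_ ?_
    · exact (hcs.mono (by rw [Set.uIcc_of_le hr.le]; exact Set.Icc_subset_Ici_self))
        |>.intervalIntegrable
    · exact (hcs.mono Set.Ioi_subset_Ici_self).stronglyMeasurableAtFilter isOpen_Ioi r hr
    · exact hcs.continuousAt (Ici_mem_nhds hr)
  have hξR : ξ R = R := by
    rw [hξ, intervalIntegral.integral_congr (g := fun _ => (1 : ℝ))]
    · simp
    · intro r hr
      rw [Set.uIcc_of_le hR.le] at hr
      simp [hnin r hr]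
  obtain ⟨M, hM, hMg⟩ := exists_abs_liouvillePotential_le hR hRR₀ hL hp
    (fun r hr => hpos r hr.le) hpout
  refine ⟨2 * (M * (2 * Real.exp (2 * M / R))) / R, by positivity, ?_⟩
  intro k K y hk hK hy hode hyR hydR r hr
  have hode' : ∀ r, R < r → deriv (deriv y) r
      + ((k : ℂ) ^ 2 * ((p r ^ 4 : ℝ) : ℂ) - (L : ℂ) / (r : ℂ) ^ 2) * y r = 0 := by
    intro r hr
    rw [hp4 r (hR.trans hr).le]
    exact hode r hr.le
  have hl := fun r (hr : R < r) => hasDerivAt_liouville (hR.trans hr) (hpos r (hR.trans hr).le)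
    (hpd r (hR.trans hr)) (hpd' r (hR.trans hr)) (hasDerivAt_derivWithin_Ici hy hr)
    (hasDerivAt_derivWithin_Ici_deriv_deriv hy hr) (hode' r hr)
  have hsub : Set.Ici R ⊆ Set.Ioi 0 := fun x hx => hR.trans_le hx
  have hpc : ContinuousOn (fun x => (p x : ℂ)) (Set.Ici R) :=
    Complex.continuous_ofReal.comp_continuousOn (hp.continuousOn.mono hsub)
  have hpc' : ContinuousOn (fun x => ((deriv p x : ℝ) : ℂ)) (Set.Ici R) :=
    Complex.continuous_ofReal.comp_continuousOn (hp'.continuousOn.mono hsub)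
  have hpne : ∀ x ∈ Set.Ici R, (p x : ℂ) ≠ 0 := fun x hx => by
    exact_mod_cast (hpos x (hsub hx).le).ne'
  have hydc : ContinuousOn (derivWithin y (Set.Ici R)) (Set.Ici R) :=
    hy.continuousOn_derivWithin (uniqueDiffOn_Ici R) (by norm_num)
  have key := norm_sub_unperturbed_oscillator_le (v := fun x => (p x : ℂ) * y x)
    (w := fun x => ((deriv p x : ℝ) : ℂ) * y x / (p x : ℂ) ^ 2
      + derivWithin y (Set.Ici R) x / p x)
    (θ := fun x => ξ x - R) (K := K) hR hM hk
    (hpc.mul hy.continuousOn)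
    (((hpc'.mul hy.continuousOn).div (hpc.pow 2) fun x hx => pow_ne_zero 2 (hpne x hx)).add
      (hydc.div hpc hpne))
    (fun x hx => ((hξd x (hsub hx)).continuousAt.sub continuousAt_const).continuousWithinAt)
    (by simp [hξR]) (fun x hx => (hl x hx).1) (fun x hx => (hl x hx).2)
    (fun x hx => by rw [hp2]; exact (hξd x (hR.trans hx)).sub_const R) hMg hK
    (by simpa [hpR] using hyR) (by simpa [hpR, hpdR] using hydR) (hRR₀.le.trans hr)
  simp only [hpR, hpdR, hpout r hr, Complex.ofReal_one, Complex.ofReal_zero, one_mul, zero_mul,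
    zero_div, zero_add, div_one] at key
  refine key.trans_eq ?_
  ring

/-- Asymptotics of the extended solution (Lemma 2.1, formula (2.14)). -/
theorem extended_solution_asymptotics
    (R R₀ : ℝ) (hR : 0 < R) (hRR₀ : R < R₀)
    (n : ℝ → ℝ) (hn : ContDiffOn ℝ 2 n (Set.Ici 0))
    (hnpos : ∀ r ∈ Set.Ici (0:ℝ), 0 < n r)
    (hnin : ∀ r ∈ Set.Icc (0:ℝ) R, n r = 1) (hnout : ∀ r ∈ Set.Ici R₀, n r = 1)
    (ξ : ℝ → ℝ) (hξ : ∀ r : ℝ, ξ r = ∫ ρ in (0:ℝ)..r, Real.sqrt (n ρ))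
    (l : ℕ)
    (y : ℂ → ℝ → ℂ)
    (hy : ∀ k : ℂ, ContDiffOn ℝ 2 (y k) (Set.Ici R))
    (hode : ∀ k : ℂ, ∀ r ∈ Set.Ici R,
      deriv (deriv (y k)) r
        + (k ^ 2 * (n r : ℂ) - ((l * (l + 1) : ℕ) : ℂ) / (r : ℂ) ^ 2) * y k r = 0)
    (hinit : ∀ k : ℂ, y k R = (R : ℂ) * sphBessel l (k * R))
    (hinit' : ∀ k : ℂ, deriv (y k) R =
      sphBessel l (k * R) + (R : ℂ) * k * deriv (sphBessel l) (k * R)) :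
    ∃ C : ℝ, 0 < C ∧ ∀ k : ℝ, 1 ≤ |k| → ∀ r : ℝ, R₀ ≤ r →
      ‖y (k : ℂ) r
          - (sphBessel l ((k : ℂ) * R) + (R : ℂ) * (k : ℂ) * deriv (sphBessel l) ((k : ℂ) * R))
              * Complex.sin ((k : ℂ) * ((ξ r - R : ℝ) : ℂ)) / (k : ℂ)
          - (R : ℂ) * sphBessel l ((k : ℂ) * R)
              * Complex.cos ((k : ℂ) * ((ξ r - R : ℝ) : ℂ))‖ ≤ C / |k| := by
  have hL : (0 : ℝ) ≤ ((l * (l + 1) : ℕ) : ℝ) := Nat.cast_nonneg _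
  obtain ⟨D, hD, hmain⟩ := exists_norm_sub_radial_asymptotics_le hR hRR₀ hL hn hnpos hnin hnout hξ
  have hode' : ∀ k : ℂ, ∀ r ∈ Set.Ici R, deriv (deriv (y k)) r
      + (k ^ 2 * (n r : ℂ) - (((l * (l + 1) : ℕ) : ℝ) : ℂ) / (r : ℂ) ^ 2) * y k r = 0 := by
    simpa only [Complex.ofReal_natCast] using hode
  obtain ⟨A, hA, hj⟩ := exists_norm_sphBessel_le l hR
  obtain ⟨B, hB, hj'⟩ := exists_norm_deriv_sphBessel_le l hR
  have hkR : ∀ k : ℝ, 1 ≤ |k| → R ≤ |k * R| := fun k hk => by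
    rw [abs_mul, abs_of_pos hR]; exact le_mul_of_one_le_left hR.le hk
  let err : ℝ → ℝ → ℂ := fun k r => y k r
    - deriv (y k) R * Complex.sin ((k : ℂ) * ((ξ r - R : ℝ) : ℂ)) / (k : ℂ)
    - y k R * Complex.cos ((k : ℂ) * ((ξ r - R : ℝ) : ℂ))
  -- The bound for one `k`, also when the two-sided derivative at `R` is a junk value.
  have hsingle : ∀ k : ℝ, ∃ C, 0 ≤ C ∧ (1 ≤ |k| → ∀ r, R₀ ≤ r → ‖err k r‖ ≤ C / |k|) := by
    intro k
    set a := derivWithin (y k) (Set.Ici R) R with ha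
    refine ⟨D * (‖y k R‖ + ‖a‖) + ‖a - deriv (y k) R‖, by positivity, fun hk r hr => ?_⟩
    have h := hmain k (‖y k R‖ + ‖a‖) (y k) hk (by positivity) (hy k) (hode' k)
      (le_add_of_nonneg_right (norm_nonneg _))
      (by nlinarith [norm_nonneg (y k R), norm_nonneg a]) r hr
    rw [← ha] at h
    have hs : ‖Complex.sin ((k : ℂ) * ((ξ r - R : ℝ) : ℂ))‖ ≤ 1 := by
      rw [← Complex.ofReal_mul, ← Complex.ofReal_sin, Complex.norm_real]
      exact Real.abs_sin_le_one _
    have h' : ‖(a - deriv (y k) R) * Complex.sin ((k : ℂ) * ((ξ r - R : ℝ) : ℂ)) / (k : ℂ)‖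
        ≤ ‖a - deriv (y k) R‖ / |k| := by
      rw [norm_div, norm_mul, Complex.norm_real, Real.norm_eq_abs]
      gcongr
      exact mul_le_of_le_one_right (norm_nonneg _) hs
    rw [add_div]
    refine le_trans (le_of_eq ?_) ((norm_add_le _ _).trans (add_le_add h h'))
    congr 1
    simp only [err]
    ring
  have hgood : ∀ k : ℝ, 1 ≤ |k| → derivWithin (y k) (Set.Ici R) R = deriv (y k) R →
      ∀ r, R₀ ≤ r → ‖err k r‖ ≤ D * (R * A + A + R * B) / |k| := by
    intro k hk heq r hr
    have h1 := hj (k * R) (hkR k hk)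
    have h2 := hj' (k * R) (hkR k hk)
    rw [Complex.ofReal_mul] at h1 h2
    have h3 : ‖(R : ℂ)‖ = R := by rw [Complex.norm_real, Real.norm_eq_abs, abs_of_pos hR]
    have h4 : ‖(k : ℂ)‖ = |k| := by rw [Complex.norm_real, Real.norm_eq_abs]
    have h := hmain k (R * A + A + R * B) (y k) hk (by positivity) (hy k) (hode' k) ?_ ?_ r hr
    · rw [heq] at h
      exact h
    · rw [hinit, norm_mul, h3]
      have := mul_le_mul_of_nonneg_left h1 hR.le
      have : 0 ≤ R * B := by positivity
      linarith
    · rw [heq, hinit']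
      refine (norm_add_le _ _).trans ?_
      rw [norm_mul, norm_mul, h3, h4]
      have h5 : R * |k| * ‖deriv (sphBessel l) (k * R)‖ ≤ R * |k| * B := by gcongr
      have h6 : A ≤ A * |k| := le_mul_of_one_le_right hA hk
      have h7 : 0 ≤ R * A * |k| := by positivity
      linarith
  -- For all but two values of `k` the two-sided derivative at `R` is the one-sided one.
  have hdich : ∀ k : ℝ, 1 ≤ |k| → k ^ 2 = ((l * (l + 1) : ℕ) : ℝ) / R ^ 2 ∨
      derivWithin (y k) (Set.Ici R) R = deriv (y k) R := by
    intro k hk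
    rcases derivWithin_Ici_eq_deriv_or (hy k) with h | ⟨h1, h2⟩
    · exact .inr h
    left
    have hk0 : (k : ℂ) ≠ 0 := by exact_mod_cast abs_pos.1 (one_pos.trans_le hk)
    have hR0 : (R : ℂ) ≠ 0 := by exact_mod_cast hR.ne'
    have h := hode' k R Set.self_mem_Ici
    rw [h2, zero_add, hnin R ⟨hR.le, le_rfl⟩, hinit] at h
    rcases mul_eq_zero.1 h with h | h
    · rw [sub_eq_zero, Complex.ofReal_one, mul_one] at h
      exact_mod_cast h
    · have hz := (mul_eq_zero.1 h).resolve_left hR0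
      rw [hinit', hz, zero_add] at h1
      exact absurd ((mul_eq_zero.1 h1).resolve_left (mul_ne_zero hR0 hk0))
        (deriv_sphBessel_ne_zero (mul_ne_zero hk0 hR0) hz)
  choose c hc hcb using hsingle
  set κ : ℝ := √(((l * (l + 1) : ℕ) : ℝ) / R ^ 2) with hκ
  have hκ2 : κ ^ 2 = ((l * (l + 1) : ℕ) : ℝ) / R ^ 2 := Real.sq_sqrt (by positivity)
  have hG : 0 ≤ D * (R * A + A + R * B) := by positivity
  refine ⟨D * (R * A + A + R * B) + c κ + c (-κ) + 1, by linarith [hc κ, hc (-κ)],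
    fun k hk r hr => ?_⟩
  rw [← hinit, ← hinit']
  have hle : ∀ C, C ≤ D * (R * A + A + R * B) + c κ + c (-κ) + 1 → ‖err k r‖ ≤ C / |k| →
      ‖err k r‖ ≤ (D * (R * A + A + R * B) + c κ + c (-κ) + 1) / |k| := fun C hC h =>
    h.trans (div_le_div_of_nonneg_right hC (abs_nonneg k))
  rcases hdich k hk with h | h
  · rw [← hκ2, sq_eq_sq_iff_eq_or_eq_neg] at h
    rcases h with h | h
    · exact hle (c k) (by rw [h]; linarith [hc (-κ)]) (hcb k hk r hr)
    · exact hle (c k) (by rw [h]; linarith [hc κ]) (hcb k hk r hr)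
  · exact hle _ (by linarith [hc κ, hc (-κ)]) (hgood k hk h r hr)
end

section
/- Indicator of the extended solution (Lemma 3.8): for every r ≥ R and every θ ∈ [0, 2π], the indicator functions of the entire functions k ↦ y(r;k) and k ↦ ∂_r y(r;k) both equal ξ(r)·|sin θ|, i.e. limsup_{ρ→∞} log|y(r; ρe^{iθ})| / ρ = ξ(r)·|sin θ| and limsup_{ρ→∞} log|∂_r y(r; ρe^{iθ})| / ρ = ξ(r)·|sin θ|. -/
open scoped Real

/-- The (Lindelöf) indicator function of order 1 of `f : ℂ → ℂ`, valued in `[−∞,+∞]`. -/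
noncomputable def indic (f : ℂ → ℂ) (θ : ℝ) : EReal :=
  Filter.limsup
    (fun r : ℝ => ((Real.log ‖f (r * Complex.exp (θ * Complex.I))‖ / r : ℝ) : EReal))
    Filter.atTop


open Polynomial in
lemma Polynomial.exists_norm_eval_le (p : ℂ[X]) :
    ∃ C : ℝ, 0 ≤ C ∧ ∀ x : ℂ, ‖x‖ ≤ 1 → ‖p.eval x‖ ≤ C := by
  obtain ⟨C, hC⟩ := (isCompact_closedBall (0 : ℂ) 1).exists_bound_of_continuousOn
    p.continuous.continuousOn
  exact ⟨C, (norm_nonneg _).trans (hC 0 (by simp)), fun x hx => hC x (by simpa using hx)⟩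

open Polynomial in
lemma Polynomial.exists_norm_eval_sub_le (p : ℂ[X]) :
    ∃ C : ℝ, 0 ≤ C ∧ ∀ x : ℂ, ‖x‖ ≤ 1 → ‖p.eval x - p.eval 0‖ ≤ C * ‖x‖ := by
  obtain ⟨C, hC0, hC⟩ := p.divX.exists_norm_eval_le
  refine ⟨C, hC0, fun x hx => ?_⟩
  have h : p.eval x - p.eval 0 = p.divX.eval x * x := by
    conv_lhs => rw [← p.divX_mul_X_add]
    simp
  rw [h, norm_mul]
  exact mul_le_mul_of_nonneg_right (hC x hx) (norm_nonneg _)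

open Polynomial in
lemma hasDerivAt_eval_inv (p : ℂ[X]) {z : ℂ} (hz : z ≠ 0) :
    HasDerivAt (fun w : ℂ => p.eval w⁻¹) (-(p.derivative.eval z⁻¹ * (z⁻¹) ^ 2)) z := by
  have h := (p.hasDerivAt z⁻¹).comp z (hasDerivAt_inv hz)
  refine h.congr_deriv ?_
  field_simp

open Polynomial in
/-- Derivative of `z ↦ e^{cz} p(1/z)`. -/
lemma hasDerivAt_exp_mul_eval_inv (p : ℂ[X]) (c : ℂ) {z : ℂ} (hz : z ≠ 0) :
    HasDerivAt (fun w : ℂ => Complex.exp (c * w) * p.eval w⁻¹)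
      (Complex.exp (c * z) * (c * p.eval z⁻¹ - p.derivative.eval z⁻¹ * (z⁻¹) ^ 2)) z := by
  have h1 : HasDerivAt (fun w : ℂ => Complex.exp (c * w)) (Complex.exp (c * z) * c) z := by
    simpa using ((hasDerivAt_id z).const_mul c).cexp
  exact (h1.mul (hasDerivAt_eval_inv p hz)).congr_deriv (by ring)

open Polynomial in
lemma iterate_csinc_eq (l : ℕ) : ∃ p q : ℂ[X], ‖p.eval 0‖ = 1 / 2 ∧ ‖q.eval 0‖ = 1 / 2 ∧
    ∀ z : ℂ, z ≠ 0 → ((fun f : ℂ → ℂ => fun w => (1 / w) * deriv f w)^[l] csinc) z =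
      (z⁻¹) ^ (l + 1) * (Complex.exp (Complex.I * z) * p.eval z⁻¹ +
        Complex.exp (-Complex.I * z) * q.eval z⁻¹) := by
  induction l with
  | zero =>
    refine ⟨C (-Complex.I / 2), C (Complex.I / 2), by simp, by simp, fun z hz => ?_⟩
    simp only [Function.iterate_zero, id, csinc, if_neg hz, Complex.sin, eval_C]
    rw [mul_comm z Complex.I, show -z * Complex.I = -Complex.I * z by ring]
    ring
  | succ l ih =>
    obtain ⟨p, q, hp, hq, h⟩ := ih
    refine ⟨C Complex.I * p - C ((l : ℂ) + 1) * X * p - X ^ 2 * derivative p,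
      C (-Complex.I) * q - C ((l : ℂ) + 1) * X * q - X ^ 2 * derivative q,
      by simpa using hp, by simpa using hq, fun z hz => ?_⟩
    rw [Function.iterate_succ_apply']
    have hpow : HasDerivAt (fun w : ℂ => (w⁻¹) ^ (l + 1))
        (((l : ℂ) + 1) * (z⁻¹) ^ l * (-(z ^ 2)⁻¹)) z := by
      have := (hasDerivAt_inv hz).pow (l + 1)
      exact this.congr_deriv (by simp)
    have hd := hpow.mul ((hasDerivAt_exp_mul_eval_inv p Complex.I hz).add
      (hasDerivAt_exp_mul_eval_inv q (-Complex.I) hz))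
    have hev : ((fun f : ℂ → ℂ => fun w => (1 / w) * deriv f w)^[l] csinc) =ᶠ[nhds z] _ :=
      (eventually_ne_nhds hz).mono fun w hw => h w hw
    have hd' := (hd.congr_of_eventuallyEq hev).deriv
    simp only [hd', eval_sub, eval_mul, eval_C, eval_X, eval_pow, Pi.add_apply]
    have hzz : (z ^ 2)⁻¹ = z⁻¹ ^ 2 := by rw [inv_pow]
    rw [hzz, one_div]
    generalize z⁻¹ = x
    ring

open Polynomial in
lemma sphBessel_eq_s12 (l : ℕ) : ∃ p q : ℂ[X], ‖p.eval 0‖ = 1 / 2 ∧ ‖q.eval 0‖ = 1 / 2 ∧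
    ∀ z : ℂ, z ≠ 0 → sphBessel l z =
      z⁻¹ * (Complex.exp (Complex.I * z) * p.eval z⁻¹ +
        Complex.exp (-Complex.I * z) * q.eval z⁻¹) := by
  obtain ⟨p, q, hp, hq, h⟩ := iterate_csinc_eq l
  refine ⟨C ((-1) ^ l) * p, C ((-1) ^ l) * q, by simpa using hp, by simpa using hq,
    fun z hz => ?_⟩
  rw [sphBessel, h z hz, neg_pow, pow_succ, inv_pow]
  simp only [eval_mul, eval_C]
  field_simp

/-- Asymptotics of the Riccati–Bessel function `v(z) = z j_l(z)`: in the closed half plane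
`Im (ε z) ≤ 0`, the combinations `v' ± i ε v` are, up to `O(1/|z|)` relative to `e^{iεz}`,
pure exponentials. -/
lemma sphBessel_asymptotics (l : ℕ) (ε : ℝ) (hε : ε = 1 ∨ ε = -1) :
    ∃ a b : ℂ, ‖a‖ = 1 ∧ ‖b‖ = 1 ∧ ∃ K : ℝ, 0 ≤ K ∧ ∀ z : ℂ, 1 ≤ ‖z‖ → (ε * z).im ≤ 0 →
      ‖Complex.exp (-(Complex.I * (ε * z))) *
        ((sphBessel l z + z * deriv (sphBessel l) z) + Complex.I * ε * (z * sphBessel l z)) - a‖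
          ≤ K / ‖z‖ ∧
      ‖Complex.exp (-(Complex.I * (ε * z))) *
        ((sphBessel l z + z * deriv (sphBessel l) z) - Complex.I * ε * (z * sphBessel l z))
          - Complex.exp (-(2 * Complex.I * (ε * z))) * b‖ ≤ K / ‖z‖ := by
  obtain ⟨p, q, hp, hq, h⟩ : ∃ p q : Polynomial ℂ, ‖p.eval 0‖ = 1 / 2 ∧ ‖q.eval 0‖ = 1 / 2 ∧
      ∀ z : ℂ, z ≠ 0 → sphBessel l z =
        z⁻¹ * (Complex.exp (Complex.I * ε * z) * p.eval z⁻¹ +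
          Complex.exp (-(Complex.I * ε) * z) * q.eval z⁻¹) := by
    obtain ⟨p, q, hp, hq, h⟩ := sphBessel_eq_s12 l
    rcases hε with rfl | rfl
    · exact ⟨p, q, hp, hq, fun z hz => by simpa using h z hz⟩
    · exact ⟨q, p, hq, hp, fun z hz => by rw [h z hz]; simp [add_comm]⟩
  have hεn : ‖(ε : ℂ)‖ = 1 := by rcases hε with rfl | rfl <;> simp
  have hεn' : |ε| = 1 := by rcases hε with rfl | rfl <;> simp
  obtain ⟨K₁, hK₁, h₁⟩ := p.exists_norm_eval_sub_le
  obtain ⟨K₂, hK₂, h₂⟩ := q.exists_norm_eval_sub_le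
  obtain ⟨K₃, hK₃, h₃⟩ := p.derivative.exists_norm_eval_le
  obtain ⟨K₄, hK₄, h₄⟩ := q.derivative.exists_norm_eval_le
  refine ⟨2 * Complex.I * ε * p.eval 0, -(2 * Complex.I * ε * q.eval 0), by rw [norm_mul, hp]; simp [hεn'],
    by rw [norm_neg, norm_mul, hq]; simp [hεn'], 2 * K₁ + 2 * K₂ + K₃ + K₄, by positivity, fun z hz him => ?_⟩
  have hz0 : z ≠ 0 := by
    rintro rfl
    simp at hz
    linarith
  set x := z⁻¹ with hx
  have hxn : ‖x‖ ≤ 1 := by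
    rw [hx, norm_inv]
    exact inv_le_one_of_one_le₀ hz
  have hKx : (2 * K₁ + 2 * K₂ + K₃ + K₄) / ‖z‖ =
      2 * K₁ * ‖x‖ + 2 * K₂ * ‖x‖ + K₃ * ‖x‖ + K₄ * ‖x‖ := by
    rw [hx, norm_inv]
    ring
  have hv : z * sphBessel l z = Complex.exp (Complex.I * ε * z) * p.eval x +
      Complex.exp (-(Complex.I * ε) * z) * q.eval x := by
    rw [h z hz0, mul_inv_cancel_left₀ hz0]
  have hdv : sphBessel l z + z * deriv (sphBessel l) z =
      Complex.exp (Complex.I * ε * z) * (Complex.I * ε * p.eval x - p.derivative.eval x * x ^ 2) +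
      Complex.exp (-(Complex.I * ε) * z) *
        (-(Complex.I * ε) * q.eval x - q.derivative.eval x * x ^ 2) := by
    have hd := (hasDerivAt_exp_mul_eval_inv p (Complex.I * ε) hz0).add
      (hasDerivAt_exp_mul_eval_inv q (-(Complex.I * ε)) hz0)
    have hj : DifferentiableAt ℂ (sphBessel l) z := by
      have hd2 := (hasDerivAt_inv hz0).mul hd
      exact (hd2.congr_of_eventuallyEq
        ((eventually_ne_nhds hz0).mono fun w hw => h w hw)).differentiableAt
    have hprod := (hasDerivAt_id z).mul hj.hasDerivAt
    have hfin := hd.congr_of_eventuallyEq (f₁ := id * sphBessel l)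
      ((eventually_ne_nhds hz0).mono fun w hw => by simp [h w hw, hw])
    have := hprod.unique hfin
    rw [← hx] at this
    simpa only [id, one_mul] using this
  set E := Complex.exp (Complex.I * ε * z) with hE
  set E' := Complex.exp (-(Complex.I * ε) * z) with hE'
  have e1 : Complex.exp (-(Complex.I * (ε * z))) = E' := by rw [hE']; ring_nf
  have e2 : Complex.exp (-(2 * Complex.I * (ε * z))) = E' * E' := by
    rw [hE', ← Complex.exp_add]; ring_nf
  have e3 : E' * E = 1 := by
    rw [hE, hE', ← Complex.exp_add]; ring_nf; simp
  have hE'n : ‖E'‖ ≤ 1 := by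
    rw [hE', Complex.norm_exp]
    apply Real.exp_le_one_iff.2
    have : (-(Complex.I * ε) * z).re = (ε * z).im := by simp
    rw [this]
    exact him
  have hxx : ‖x ^ 2‖ ≤ ‖x‖ := by
    rw [norm_pow, sq]
    exact mul_le_of_le_one_left (norm_nonneg _) hxn
  have hEE : ‖E' * E'‖ ≤ 1 := by
    rw [norm_mul]
    exact mul_le_one₀ hE'n (norm_nonneg _) hE'n
  have b3 : ‖p.derivative.eval x * x ^ 2‖ ≤ K₃ * ‖x‖ := by
    rw [norm_mul]
    exact mul_le_mul (h₃ x hxn) hxx (norm_nonneg _) hK₃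
  have b4 : ‖E' * E' * (q.derivative.eval x * x ^ 2)‖ ≤ K₄ * ‖x‖ := by
    rw [norm_mul, ← one_mul (K₄ * ‖x‖), norm_mul (Polynomial.eval _ _)]
    exact mul_le_mul hEE (mul_le_mul (h₄ x hxn) hxx (norm_nonneg _) hK₄) (by positivity) one_pos.le
  have b1 : ‖2 * Complex.I * ε * (p.eval x - p.eval 0)‖ ≤ 2 * K₁ * ‖x‖ := by
    rw [norm_mul]
    simp only [norm_mul, hεn, Complex.norm_I, Complex.norm_ofNat]
    linarith [h₁ x hxn]
  have b2 : ‖E' * E' * (2 * Complex.I * ε * (q.eval x - q.eval 0))‖ ≤ 2 * K₂ * ‖x‖ := by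
    rw [norm_mul, ← one_mul (2 * K₂ * ‖x‖)]
    refine mul_le_mul hEE ?_ (norm_nonneg _) one_pos.le
    simp only [norm_mul, hεn, Complex.norm_I, Complex.norm_ofNat]
    linarith [h₂ x hxn]
  have n1 : 0 ≤ K₁ * ‖x‖ := by positivity
  have n2 : 0 ≤ K₂ * ‖x‖ := by positivity
  rw [e1, e2, hv, hdv, hKx]
  constructor
  · have : E' * (E * (Complex.I * ε * p.eval x - p.derivative.eval x * x ^ 2) +
          E' * (-(Complex.I * ε) * q.eval x - q.derivative.eval x * x ^ 2) +
          Complex.I * ε * (E * p.eval x + E' * q.eval x)) - 2 * Complex.I * ε * p.eval 0 =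
        2 * Complex.I * ε * (p.eval x - p.eval 0) - p.derivative.eval x * x ^ 2 -
          E' * E' * (q.derivative.eval x * x ^ 2) := by
      linear_combination (2 * Complex.I * ε * p.eval x - p.derivative.eval x * x ^ 2) * e3
    rw [this]
    refine (norm_sub_le _ _).trans ?_
    have := norm_sub_le (2 * Complex.I * ε * (p.eval x - p.eval 0)) (p.derivative.eval x * x ^ 2)
    linarith
  · have : E' * (E * (Complex.I * ε * p.eval x - p.derivative.eval x * x ^ 2) +
          E' * (-(Complex.I * ε) * q.eval x - q.derivative.eval x * x ^ 2) -
          Complex.I * ε * (E * p.eval x + E' * q.eval x)) -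
          E' * E' * -(2 * Complex.I * ε * q.eval 0) =
        -(E' * E' * (2 * Complex.I * ε * (q.eval x - q.eval 0))) - p.derivative.eval x * x ^ 2 -
          E' * E' * (q.derivative.eval x * x ^ 2) := by
      linear_combination (- p.derivative.eval x * x ^ 2) * e3
    rw [this]
    refine (norm_sub_le _ _).trans ?_
    have := norm_sub_le (-(E' * E' * (2 * Complex.I * ε * (q.eval x - q.eval 0))))
      (p.derivative.eval x * x ^ 2)
    rw [norm_neg] at this
    linarith

/-- Grönwall's inequality for a function differentiable in the interior of an interval. -/
lemma le_mul_exp_of_hasDerivAt_le {H H' : ℝ → ℝ} {c a b : ℝ} (hab : a ≤ b)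
    (hc : ContinuousOn H (Set.Icc a b)) (hd : ∀ x ∈ Set.Ioo a b, HasDerivAt H (H' x) x)
    (hle : ∀ x ∈ Set.Ioo a b, H' x ≤ c * H x) : H b ≤ H a * Real.exp (c * (b - a)) := by
  have hE : ∀ x : ℝ, HasDerivAt (fun x : ℝ => Real.exp (-(c * x))) (Real.exp (-(c * x)) * -c) x := by
    intro x
    simpa using ((hasDerivAt_id x).const_mul c).neg.exp
  have hanti : AntitoneOn (fun x => H x * Real.exp (-(c * x))) (Set.Icc a b) := by
    refine antitoneOn_of_hasDerivWithinAt_nonpos (convex_Icc a b)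
      (hc.mul (fun x _ => (hE x).continuousAt.continuousWithinAt))
      (f' := fun x => H' x * Real.exp (-(c * x)) + H x * (Real.exp (-(c * x)) * -c)) ?_ ?_
    · intro x hx
      rw [interior_Icc] at hx
      exact ((hd x hx).mul (hE x)).hasDerivWithinAt
    · intro x hx
      rw [interior_Icc] at hx
      nlinarith [mul_nonneg (sub_nonneg.2 (hle x hx)) (Real.exp_pos (-(c * x))).le]
  have h := hanti (Set.left_mem_Icc.2 hab) (Set.right_mem_Icc.2 hab) hab
  have h2 := mul_le_mul_of_nonneg_right h (Real.exp_pos (c * b)).le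
  simp only [mul_assoc, ← Real.exp_add] at h2
  rw [show -(c * b) + c * b = 0 by ring, show -(c * a) + c * b = c * (b - a) by ring] at h2
  simpa using h2

/-- WKB estimate for the first-order system `Y' = σ P`, `P' = -κ² σ Y + g Y`, with phase `ξ`,
`ξ' = σ ≥ 0`, and spectral parameter `κ` in the closed lower half plane. -/
lemma wkb_estimate {a b : ℝ} (hab : a ≤ b) {κ : ℂ} (hκ : 1 ≤ ‖κ‖) (him : κ.im ≤ 0)
    {Y P : ℝ → ℂ} {σ g ξ : ℝ → ℝ} {G K : ℝ} (hG : 0 ≤ G)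
    (hYc : ContinuousOn Y (Set.Icc a b)) (hPc : ContinuousOn P (Set.Icc a b))
    (hξc : ContinuousOn ξ (Set.Icc a b))
    (hY : ∀ x ∈ Set.Ioo a b, HasDerivAt Y (σ x * P x) x)
    (hP : ∀ x ∈ Set.Ioo a b, HasDerivAt P (-(κ ^ 2 * σ x * Y x) + g x * Y x) x)
    (hξ : ∀ x ∈ Set.Ioo a b, HasDerivAt ξ (σ x) x)
    (hσ : ∀ x ∈ Set.Ioo a b, 0 ≤ σ x) (hg : ∀ x ∈ Set.Ioo a b, |g x| ≤ G)
    (hξ0 : ∀ x ∈ Set.Ioo a b, 0 ≤ ξ x) {α β : ℂ} (hα : ‖α‖ = 1) (hβ : ‖β‖ = 1)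
    (h1 : ‖Complex.exp (-(Complex.I * κ * ξ a)) * (P a + Complex.I * κ * Y a) - α‖ ≤ K / ‖κ‖)
    (h2 : ‖Complex.exp (-(Complex.I * κ * ξ a)) * (P a - Complex.I * κ * Y a) -
      Complex.exp (-(2 * Complex.I * κ * ξ a)) * β‖ ≤ K / ‖κ‖) :
    ‖Complex.exp (-(Complex.I * κ * ξ b)) * (P b + Complex.I * κ * Y b) - α‖ ≤
      √((2 * K ^ 2 + 1) * Real.exp (4 * G * (b - a))) / ‖κ‖ ∧
    ‖Complex.exp (-(Complex.I * κ * ξ b)) * (P b - Complex.I * κ * Y b) -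
      Complex.exp (-(2 * Complex.I * κ * ξ b)) * β‖ ≤
      √((2 * K ^ 2 + 1) * Real.exp (4 * G * (b - a))) / ‖κ‖ := by
  have hκ0 : 0 < ‖κ‖ := by linarith
  have hκne : κ ≠ 0 := norm_pos_iff.1 hκ0
  set E : ℝ → ℂ := fun x => Complex.exp (-(Complex.I * κ * ξ x)) with hEdef
  set E2 : ℝ → ℂ := fun x => Complex.exp (-(2 * Complex.I * κ * ξ x)) with hE2def
  set u : ℝ → ℂ := fun x => E x * (P x + Complex.I * κ * Y x) - α with hu
  set v : ℝ → ℂ := fun x => E x * (P x - Complex.I * κ * Y x) - E2 x * β with hv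
  have hξcc : ContinuousOn (fun x => (ξ x : ℂ)) (Set.Icc a b) :=
    Complex.continuous_ofReal.comp_continuousOn hξc
  have hEc : ContinuousOn E (Set.Icc a b) := by fun_prop
  have hE2c : ContinuousOn E2 (Set.Icc a b) := by fun_prop
  have huc : ContinuousOn u (Set.Icc a b) := by fun_prop
  have hvc : ContinuousOn v (Set.Icc a b) := by fun_prop
  have hE : ∀ x ∈ Set.Ioo a b, HasDerivAt E (-(Complex.I * κ * σ x) * E x) x := fun x hx =>
    (((hξ x hx).ofReal_comp.const_mul (Complex.I * κ)).neg.cexp).congr_deriv (by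
      simp only [hEdef, Pi.neg_apply]; ring)
  have hE2 : ∀ x ∈ Set.Ioo a b, HasDerivAt E2 (-(2 * Complex.I * κ * σ x) * E2 x) x := fun x hx =>
    (((hξ x hx).ofReal_comp.const_mul (2 * Complex.I * κ)).neg.cexp).congr_deriv (by
      simp only [hE2def, Pi.neg_apply]; ring)
  set w : ℝ → ℂ := fun x => E x * (g x * Y x) with hw
  have hud : ∀ x ∈ Set.Ioo a b, HasDerivAt u (w x) x := fun x hx =>
    (((hE x hx).mul ((hP x hx).add ((hY x hx).const_mul (Complex.I * κ)))).sub_const α).congr_deriv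
      (by
        simp only [hw, Pi.add_apply]
        linear_combination (-(κ ^ 2 * σ x * Y x * E x)) * Complex.I_sq)
  have hvd : ∀ x ∈ Set.Ioo a b, HasDerivAt v (-(2 * Complex.I * κ * σ x) * v x + w x) x :=
    fun x hx =>
    (((hE x hx).mul ((hP x hx).sub ((hY x hx).const_mul (Complex.I * κ)))).sub
      ((hE2 x hx).mul_const β)).congr_deriv
      (by
        simp only [hw, hv, Pi.sub_apply]
        linear_combination (-(κ ^ 2 * σ x * Y x * E x)) * Complex.I_sq)
  have hE2n : ∀ x ∈ Set.Ioo a b, ‖E2 x‖ ≤ 1 := fun x hx => by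
    simp only [hE2def, Complex.norm_exp]
    apply Real.exp_le_one_iff.2
    have : (-(2 * Complex.I * κ * ξ x)).re = 2 * (κ.im * ξ x) := by simp; ring
    rw [this]
    have := mul_nonpos_of_nonpos_of_nonneg him (hξ0 x hx)
    linarith
  have hwn : ∀ x ∈ Set.Ioo a b, ‖w x‖ ≤ G * ‖κ‖⁻¹ * (‖u x‖ + ‖v x‖ + 2) / 2 := fun x hx => by
    have hid : w x = g x * (2 * Complex.I * κ)⁻¹ * (u x - v x + α - E2 x * β) := by
      simp only [hw, hu, hv]
      field_simp
      ring
    have hn : ‖u x - v x + α - E2 x * β‖ ≤ ‖u x‖ + ‖v x‖ + 2 := by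
      have n1 := norm_sub_le (u x - v x + α) (E2 x * β)
      have n2 := norm_add_le (u x - v x) α
      have n3 := norm_sub_le (u x) (v x)
      rw [norm_mul, hβ, mul_one] at n1
      linarith [hE2n x hx]
    rw [hid, norm_mul, norm_mul, norm_inv, norm_mul, norm_mul, Complex.norm_I, Complex.norm_ofNat,
      Complex.norm_real, Real.norm_eq_abs]
    calc |g x| * (2 * 1 * ‖κ‖)⁻¹ * ‖u x - v x + α - E2 x * β‖
        ≤ G * (2 * 1 * ‖κ‖)⁻¹ * (‖u x‖ + ‖v x‖ + 2) := by
          have := hg x hx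
          gcongr
      _ = _ := by rw [mul_one, mul_inv]; ring
  have ht1 : ‖κ‖⁻¹ ≤ 1 := inv_le_one_of_one_le₀ hκ
  have ht0 : 0 < ‖κ‖⁻¹ := inv_pos.2 hκ0
  set t := ‖κ‖⁻¹ with ht
  have hmain := le_mul_exp_of_hasDerivAt_le (H := fun x => ‖u x‖ ^ 2 + ‖v x‖ ^ 2 + t ^ 2)
    (H' := fun x => 2 * inner ℝ (u x) (w x) +
      2 * inner ℝ (v x) (-(2 * Complex.I * κ * σ x) * v x + w x)) (c := 4 * G) hab
    (by fun_prop)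
    (fun x hx => (((hud x hx).norm_sq).add ((hvd x hx).norm_sq)).add_const _) ?_
  · have hKt : K / ‖κ‖ = K * t := div_eq_mul_inv _ _
    have hu1 : ‖u a‖ ≤ K * t := hKt ▸ h1
    have hv1 : ‖v a‖ ≤ K * t := hKt ▸ h2
    have hu2 : ‖u a‖ ^ 2 ≤ (K * t) ^ 2 := pow_le_pow_left₀ (norm_nonneg _) hu1 2
    have hv2 : ‖v a‖ ^ 2 ≤ (K * t) ^ 2 := pow_le_pow_left₀ (norm_nonneg _) hv1 2
    have hfin : ‖u b‖ ^ 2 + ‖v b‖ ^ 2 + t ^ 2 ≤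
        (2 * K ^ 2 + 1) * Real.exp (4 * G * (b - a)) * t ^ 2 := by
      refine hmain.trans ?_
      have : ‖u a‖ ^ 2 + ‖v a‖ ^ 2 + t ^ 2 ≤ (2 * K ^ 2 + 1) * t ^ 2 := by linarith
      calc _ ≤ (2 * K ^ 2 + 1) * t ^ 2 * Real.exp (4 * G * (b - a)) := by gcongr
        _ = _ := by ring
    have hsq : ∀ z : ℂ, ‖z‖ ^ 2 ≤ (2 * K ^ 2 + 1) * Real.exp (4 * G * (b - a)) * t ^ 2 →
        ‖z‖ ≤ √((2 * K ^ 2 + 1) * Real.exp (4 * G * (b - a))) / ‖κ‖ := by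
      intro z hz
      have := Real.le_sqrt_of_sq_le hz
      rwa [Real.sqrt_mul (by positivity), Real.sqrt_sq ht0.le, ← div_eq_mul_inv] at this
    exact ⟨hsq (u b) (by nlinarith [sq_nonneg ‖v b‖, sq_nonneg t]),
      hsq (v b) (by nlinarith [sq_nonneg ‖u b‖, sq_nonneg t])⟩
  · intro x hx
    have i1 : inner ℝ (u x) (w x) ≤ ‖u x‖ * ‖w x‖ := real_inner_le_norm _ _
    have i2 : inner ℝ (v x) (w x) ≤ ‖v x‖ * ‖w x‖ := real_inner_le_norm _ _
    have i3 : inner ℝ (v x) (-(2 * Complex.I * κ * σ x) * v x) ≤ 0 := by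
      have : inner ℝ (v x) (-(2 * Complex.I * κ * σ x) * v x) =
          2 * (κ.im * σ x) * Complex.normSq (v x) := by
        rw [Complex.inner, Complex.normSq_apply]
        simp
        ring
      rw [this]
      have := mul_nonpos_of_nonpos_of_nonneg him (hσ x hx)
      exact mul_nonpos_of_nonpos_of_nonneg (by linarith) (Complex.normSq_nonneg _)
    simp only [inner_add_right]
    have hs : 0 ≤ ‖u x‖ + ‖v x‖ := by positivity
    have j := mul_le_mul_of_nonneg_left (hwn x hx) hs
    have j2 : (‖u x‖ + ‖v x‖) * t * (‖u x‖ + ‖v x‖ + 2) ≤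
        4 * (‖u x‖ ^ 2 + ‖v x‖ ^ 2 + t ^ 2) := by
      have k1 : (‖u x‖ + ‖v x‖) ^ 2 * t ≤ (‖u x‖ + ‖v x‖) ^ 2 :=
        mul_le_of_le_one_right (sq_nonneg _) ht1
      nlinarith [sq_nonneg (‖u x‖ - ‖v x‖), sq_nonneg (‖u x‖ + ‖v x‖ - t), sq_nonneg t]
    have j3 := mul_le_mul_of_nonneg_left j2 hG
    nlinarith

lemma frequently_half_le_norm_add_exp {c : ℂ} (hc : c ≠ 0) (hre : 0 ≤ c.re) {α β : ℂ}
    (hα : ‖α‖ = 1) :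
    ∃ᶠ t : ℝ in Filter.atTop, 1 / 2 ≤ ‖α + Complex.exp (-(c * t)) * β‖ := by
  intro hev
  simp only [not_le] at hev
  rcases hre.eq_or_lt with h0 | hpos
  · have him : c.im ≠ 0 := fun h => hc (Complex.ext h0.symm h)
    have hcI : c = c.im * Complex.I := Complex.ext (by simp [← h0]) (by simp)
    have hev2 : ∀ᶠ t : ℝ in Filter.atTop,
        ‖α + Complex.exp (-(c * ((t + π / |c.im| : ℝ) : ℂ))) * β‖ < 1 / 2 :=
      (Filter.tendsto_atTop_add_const_right _ _ Filter.tendsto_id).eventually hev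
    obtain ⟨t, ht1, ht2⟩ := (hev.and hev2).exists
    have hexp : Complex.exp (-(c * ((t + π / |c.im| : ℝ) : ℂ))) = -Complex.exp (-(c * t)) := by
      rcases abs_choice c.im with h | h
      · have : -(c * ((t + π / |c.im| : ℝ) : ℂ)) = -(c * t) - π * Complex.I := by
          rw [h]
          have : (c.im : ℂ) ≠ 0 := by exact_mod_cast him
          push_cast
          nth_rw 1 [hcI]
          nth_rw 3 [hcI]
          field_simp
          ring
        rw [this, Complex.exp_sub_pi_mul_I]
      · have : -(c * ((t + π / |c.im| : ℝ) : ℂ)) = -(c * t) + π * Complex.I := by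
          rw [h]
          have : (c.im : ℂ) ≠ 0 := by exact_mod_cast him
          push_cast
          nth_rw 1 [hcI]
          nth_rw 3 [hcI]
          field_simp
          ring
        rw [this, Complex.exp_add_pi_mul_I]
    have hsum := norm_add_le (α + Complex.exp (-(c * t)) * β)
      (α + Complex.exp (-(c * ((t + π / |c.im| : ℝ) : ℂ))) * β)
    have h2 : α + Complex.exp (-(c * t)) * β +
        (α + Complex.exp (-(c * ((t + π / |c.im| : ℝ) : ℂ))) * β) = 2 * α := by
      rw [hexp]; ring
    rw [h2, norm_mul, hα, Complex.norm_ofNat] at hsum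
    linarith
  · have hlim : Filter.Tendsto (fun t : ℝ => ‖α + Complex.exp (-(c * t)) * β‖) Filter.atTop
        (nhds 1) := by
      have hz : Filter.Tendsto (fun t : ℝ => Complex.exp (-(c * t))) Filter.atTop (nhds 0) := by
        rw [tendsto_zero_iff_norm_tendsto_zero]
        simp only [Complex.norm_exp]
        apply Real.tendsto_exp_atBot.comp
        have : ∀ t : ℝ, (-(c * t)).re = -(c.re * t) := fun t => by simp
        simp only [this]
        exact Filter.tendsto_neg_atTop_atBot.comp (Filter.tendsto_id.const_mul_atTop hpos)
      have := ((hz.mul_const β).const_add α).norm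
      simpa [hα] using this
    obtain ⟨t, h1, h2⟩ :=
      (hev.and (hlim.eventually (lt_mem_nhds (by norm_num : (1 / 2 : ℝ) < 1)))).exists
    exact absurd h1 (not_lt.2 h2.le)

lemma indic_eq_of_bounds {f : ℂ → ℂ} {θ S C c : ℝ} (hS : 0 ≤ S) (hC : 1 ≤ C) (hc : 0 < c)
    (hup : ∀ᶠ t : ℝ in Filter.atTop,
      ‖f (t * Complex.exp (θ * Complex.I))‖ ≤ Real.exp (S * t) * C)
    (hlow : ∃ᶠ t : ℝ in Filter.atTop,
      Real.exp (S * t) * (c / t) ≤ ‖f (t * Complex.exp (θ * Complex.I))‖) :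
    indic f θ = (S : EReal) := by
  apply le_antisymm
  · have hlim : Filter.Tendsto (fun t : ℝ => ((S + Real.log C / t : ℝ) : EReal)) Filter.atTop
        (nhds (S : EReal)) := by
      refine (continuous_coe_real_ereal.tendsto S).comp ?_
      simpa using (Filter.Tendsto.div_atTop (tendsto_const_nhds (x := Real.log C))
        Filter.tendsto_id).const_add S
    rw [← hlim.limsup_eq]
    refine Filter.limsup_le_limsup ?_
    filter_upwards [hup, Filter.eventually_gt_atTop 0] with t ht ht0
    rw [EReal.coe_le_coe_iff, div_le_iff₀ ht0, add_mul, div_mul_cancel₀ _ ht0.ne']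
    rcases (norm_nonneg (f (t * Complex.exp (θ * Complex.I)))).eq_or_lt with h0 | hpos
    · rw [← h0, Real.log_zero]
      have := Real.log_nonneg hC
      positivity
    · have := Real.log_le_log hpos ht
      rwa [Real.log_mul (Real.exp_pos _).ne' (by linarith), Real.log_exp] at this
  · refine le_of_forall_lt fun x hx => ?_
    obtain ⟨q, hxq, hqS⟩ := EReal.lt_iff_exists_real_btwn.1 hx
    rw [EReal.coe_lt_coe_iff] at hqS
    refine hxq.trans_le ?_
    have hlim : Filter.Tendsto (fun t : ℝ => S + (Real.log c / t - Real.log t / t)) Filter.atTop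
        (nhds S) := by
      have h1 : Filter.Tendsto (fun t : ℝ => Real.log c / t) Filter.atTop (nhds 0) :=
        Filter.Tendsto.div_atTop tendsto_const_nhds Filter.tendsto_id
      have h2 : Filter.Tendsto (fun t : ℝ => Real.log t / t) Filter.atTop (nhds 0) :=
        Real.isLittleO_log_id_atTop.tendsto_div_nhds_zero
      simpa using (h1.sub h2).const_add S
    refine Filter.le_limsup_of_frequently_le ?_
    refine (hlow.and_eventually ((hlim.eventually (lt_mem_nhds hqS)).and
      (Filter.eventually_gt_atTop 0))).mono ?_
    rintro t ⟨ht, hqt, ht0⟩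
    rw [EReal.coe_le_coe_iff]
    refine hqt.le.trans ?_
    rw [le_div_iff₀ ht0]
    have := Real.log_le_log (by positivity) ht
    rw [Real.log_mul (Real.exp_pos _).ne' (by positivity), Real.log_exp,
      Real.log_div hc.ne' ht0.ne'] at this
    refine le_trans (le_of_eq ?_) this
    field_simp

lemma indic_eq_of_wkb {f f' : ℂ → ℂ} {θ ε x m m' K N : ℝ} {α β : ℂ} (hε : ε = 1 ∨ ε = -1)
    (hsin : ε * Real.sin θ = -|Real.sin θ|) (hx : 0 < x) (hm : 0 < m) (hK : 0 ≤ K)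
    (hα : ‖α‖ = 1) (hβ : ‖β‖ = 1)
    (h : ∀ k : ℂ, N ≤ ‖k‖ → (ε * k).im ≤ 0 →
      ‖Complex.exp (-(Complex.I * (ε * k) * x)) *
        ((m' * f k + m * f' k) / m ^ 2 + Complex.I * (ε * k) * (m * f k)) - α‖ ≤ K / ‖k‖ ∧
      ‖Complex.exp (-(Complex.I * (ε * k) * x)) *
        ((m' * f k + m * f' k) / m ^ 2 - Complex.I * (ε * k) * (m * f k)) -
        Complex.exp (-(2 * Complex.I * (ε * k) * x)) * β‖ ≤ K / ‖k‖) :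
    indic f θ = ((x * |Real.sin θ| : ℝ) : EReal) ∧
      indic f' θ = ((x * |Real.sin θ| : ℝ) : EReal) := by
  have hεn : ‖(ε : ℂ)‖ = 1 := by rcases hε with rfl | rfl <;> simp
  have hmC : (m : ℂ) ≠ 0 := by exact_mod_cast hm.ne'
  set S := x * |Real.sin θ| with hS
  have hS0 : 0 ≤ S := by positivity
  set c : ℂ := 2 * Complex.I * ε * Complex.exp (θ * Complex.I) * x with hc
  have hcn : c ≠ 0 := by
    have : (ε : ℂ) ≠ 0 := norm_pos_iff.1 (by rw [hεn]; exact one_pos)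
    have : (x : ℂ) ≠ 0 := by exact_mod_cast hx.ne'
    simp_all
  have hcre : c.re = 2 * S := by
    have : c = ((2 * ε * x : ℝ) : ℂ) * (Complex.exp (θ * Complex.I) * Complex.I) := by
      rw [hc]; push_cast; ring
    rw [this, Complex.re_ofReal_mul, Complex.mul_I_re, Complex.exp_ofReal_mul_I_im, hS]
    linear_combination (-(2 * x)) * hsin
  set κ : ℝ → ℂ := fun t => ε * (t * Complex.exp (θ * Complex.I)) with hκ
  set Y : ℝ → ℂ := fun t => f (t * Complex.exp (θ * Complex.I)) with hY
  set Y' : ℝ → ℂ := fun t => f' (t * Complex.exp (θ * Complex.I)) with hY'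
  set E : ℝ → ℂ := fun t => Complex.exp (-(Complex.I * κ t * x)) with hE
  set A : ℝ → ℂ := fun t => E t *
    ((m' * Y t + m * Y' t) / m ^ 2 + Complex.I * κ t * (m * Y t)) with hA
  set B : ℝ → ℂ := fun t => E t *
    ((m' * Y t + m * Y' t) / m ^ 2 - Complex.I * κ t * (m * Y t)) with hB
  have hκn : ∀ t : ℝ, 0 < t → ‖κ t‖ = t := fun t ht => by
    simp only [hκ, norm_mul, hεn, Complex.norm_exp_ofReal_mul_I, Complex.norm_real,
      Real.norm_eq_abs, abs_of_pos ht]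
    ring
  have hkn : ∀ t : ℝ, 0 < t → ‖(t : ℂ) * Complex.exp (θ * Complex.I)‖ = t := fun t ht => by
    rw [norm_mul, Complex.norm_exp_ofReal_mul_I, Complex.norm_real, Real.norm_eq_abs,
      abs_of_pos ht, mul_one]
  have hEn : ∀ t : ℝ, ‖E t‖ * Real.exp (S * t) = 1 := fun t => by
    have : -(Complex.I * κ t * x) = ((-(t / 2) : ℝ) : ℂ) * c := by
      simp only [hκ, hc]; push_cast; ring
    simp only [hE, this, Complex.norm_exp, Complex.re_ofReal_mul, hcre, ← Real.exp_add]
    rw [show -(t / 2) * (2 * S) + S * t = 0 by ring, Real.exp_zero]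
  have hkim : ∀ t : ℝ, 0 < t → (ε * (t * Complex.exp (θ * Complex.I)) : ℂ).im ≤ 0 :=
    fun t ht => by
    have : (ε * (t * Complex.exp (θ * Complex.I)) : ℂ).im = t * (ε * Real.sin θ) := by
      rw [Complex.im_ofReal_mul, Complex.im_ofReal_mul, Complex.exp_ofReal_mul_I_im]; ring
    rw [this, hsin]
    have := mul_nonneg ht.le (abs_nonneg (Real.sin θ))
    linarith
  have hexp2 : ∀ t : ℝ, Complex.exp (-(2 * Complex.I * κ t * x)) = Complex.exp (-(c * t)) :=
    fun t => by simp only [hκ, hc]; ring_nf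
  have hAB : ∀ t : ℝ, max N 1 ≤ t → ‖A t - α‖ ≤ K / t ∧
      ‖B t - Complex.exp (-(c * t)) * β‖ ≤ K / t := fun t ht => by
    have ht0 : 0 < t := by linarith [le_max_right N 1]
    have := h (t * Complex.exp (θ * Complex.I)) (by rw [hkn t ht0]; exact (le_max_left _ _).trans ht)
      (hkim t ht0)
    rw [hkn t ht0] at this
    refine ⟨this.1, ?_⟩
    rw [← hexp2]
    exact this.2
  have hE2 : ∀ t : ℝ, 0 < t → ‖Complex.exp (-(c * t))‖ ≤ 1 := fun t ht => by
    rw [Complex.norm_exp]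
    apply Real.exp_le_one_iff.2
    have : (-(c * t)).re = -(2 * S * t) := by simp [hcre]
    rw [this]
    have : 0 ≤ S * t := by positivity
    linarith
  have hAn : ∀ t : ℝ, max N 1 ≤ t → ‖A t‖ ≤ 1 + K ∧ ‖B t‖ ≤ 1 + K := fun t ht => by
    have ht1 : 1 ≤ t := (le_max_right N 1).trans ht
    have hKt : K / t ≤ K := div_le_self hK ht1
    obtain ⟨h1, h2⟩ := hAB t ht
    have h3 := norm_le_norm_add_norm_sub' (A t) α
    have h4 := norm_le_norm_add_norm_sub' (B t) (Complex.exp (-(c * t)) * β)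
    rw [norm_mul (Complex.exp (-(c * t))) β, hβ, mul_one] at h4
    have := hE2 t (by linarith)
    constructor <;> linarith
  have hYid : ∀ t : ℝ, 0 < t → ‖Y t‖ = Real.exp (S * t) * (‖A t - B t‖ / (2 * t * m)) :=
    fun t ht => by
    have : A t - B t = E t * (2 * Complex.I * κ t * m * Y t) := by simp only [hA, hB]; ring
    rw [this]
    simp only [norm_mul, hκn t ht, Complex.norm_I, Complex.norm_ofNat, Complex.norm_real,
      Real.norm_eq_abs, abs_of_pos hm]
    have := hEn t
    field_simp
    linear_combination (-‖Y t‖) * this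
  have hY'id : ∀ t : ℝ, 0 < t → ‖Y' t‖ = Real.exp (S * t) *
      ‖m / 2 * (A t + B t) - m' / m ^ 2 * ((A t - B t) / (2 * Complex.I * κ t))‖ := fun t ht => by
    have hκ0 : κ t ≠ 0 := norm_pos_iff.1 (by rw [hκn t ht]; exact ht)
    have : m / 2 * (A t + B t) - m' / m ^ 2 * ((A t - B t) / (2 * Complex.I * κ t)) =
        E t * Y' t := by
      simp only [hA, hB]
      field_simp
      ring
    rw [this, norm_mul, ← mul_assoc, mul_comm (Real.exp _), hEn, one_mul]
  have hcorr : ∀ t : ℝ, max N 1 ≤ t →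
      ‖(m' : ℂ) / m ^ 2 * ((A t - B t) / (2 * Complex.I * κ t))‖ ≤ |m'| / m ^ 2 * (1 + K) / t :=
    fun t ht => by
    have ht1 : 1 ≤ t := (le_max_right N 1).trans ht
    have ht0 : 0 < t := by linarith
    simp only [norm_mul, norm_div, norm_pow, hκn t ht0, Complex.norm_I, Complex.norm_ofNat,
      Complex.norm_real, Real.norm_eq_abs, abs_of_pos hm]
    have h1 := norm_sub_le (A t) (B t)
    have h2 := hAn t ht
    rw [mul_div_assoc]
    refine mul_le_mul_of_nonneg_left ?_ (by positivity)
    rw [div_le_div_iff₀ (by positivity) ht0]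
    nlinarith
  have hKlim : Filter.Tendsto (fun t : ℝ => K / t) Filter.atTop (nhds 0) :=
    Filter.Tendsto.div_atTop tendsto_const_nhds Filter.tendsto_id
  have hClim : Filter.Tendsto (fun t : ℝ => |m'| / m ^ 2 * (1 + K) / t) Filter.atTop (nhds 0) :=
    Filter.Tendsto.div_atTop tendsto_const_nhds Filter.tendsto_id
  have hlarge := Filter.eventually_ge_atTop (max N 1)
  have hKsmall := hKlim.eventually (gt_mem_nhds (by norm_num : (0 : ℝ) < 1 / 8))
  have hCsmall := hClim.eventually (gt_mem_nhds (by positivity : (0 : ℝ) < m / 16))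
  constructor
  · refine indic_eq_of_bounds (C := 1 + (1 + K) / m) (c := 1 / (8 * m)) hS0
      (by have : 0 ≤ (1 + K) / m := by positivity
          linarith) (by positivity) ?_ ?_
    · filter_upwards [hlarge] with t ht
      have ht1 : 1 ≤ t := (le_max_right N 1).trans ht
      have ht0 : 0 < t := by linarith
      change ‖Y t‖ ≤ _
      rw [hYid t ht0]
      gcongr
      have h1 := norm_sub_le (A t) (B t)
      have h2 := hAn t ht
      calc ‖A t - B t‖ / (2 * t * m) ≤ (2 * (1 + K)) / (2 * 1 * m) := by
            gcongr
            linarith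
        _ = (1 + K) / m := by field_simp
        _ ≤ _ := by linarith
    · refine ((frequently_half_le_norm_add_exp hcn (by rw [hcre]; positivity) hα
        (β := -β)).and_eventually (hlarge.and hKsmall)).mono ?_
      rintro t ⟨hf, ht, hs⟩
      have ht1 : 1 ≤ t := (le_max_right N 1).trans ht
      have ht0 : 0 < t := by linarith
      change _ ≤ ‖Y t‖
      rw [hYid t ht0]
      obtain ⟨h1, h2⟩ := hAB t ht
      have h3 : 1 / 4 ≤ ‖A t - B t‖ := by
        have h4 := norm_le_norm_add_norm_sub' (α + Complex.exp (-(c * t)) * -β) (A t - B t)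
        have h5 : α + Complex.exp (-(c * t)) * -β - (A t - B t) =
          (B t - Complex.exp (-(c * t)) * β) - (A t - α) := by ring
        rw [h5] at h4
        have h6 := norm_sub_le (B t - Complex.exp (-(c * t)) * β) (A t - α)
        linarith
      refine mul_le_mul_of_nonneg_left ?_ (Real.exp_pos _).le
      rw [div_div, div_le_div_iff₀ (by positivity) (by positivity)]
      have : 0 < t * m := by positivity
      nlinarith
  · refine indic_eq_of_bounds (C := 1 + (m * (1 + K) + |m'| / m ^ 2 * (1 + K)))
      (c := m / 16) hS0 (by have : 0 ≤ m * (1 + K) + |m'| / m ^ 2 * (1 + K) := by positivity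
                            linarith) (by positivity) ?_ ?_
    · filter_upwards [hlarge] with t ht
      have ht1 : 1 ≤ t := (le_max_right N 1).trans ht
      have ht0 : 0 < t := by linarith
      change ‖Y' t‖ ≤ _
      rw [hY'id t ht0]
      gcongr
      refine (norm_sub_le _ _).trans ?_
      have h1 := norm_add_le (A t) (B t)
      have h2 := hAn t ht
      have h3 : |m'| / m ^ 2 * (1 + K) / t ≤ |m'| / m ^ 2 * (1 + K) :=
        div_le_self (by positivity) ht1
      have h4 := hcorr t ht
      have h5 : ‖(m : ℂ) / 2 * (A t + B t)‖ ≤ m * (1 + K) := by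
        rw [norm_mul, norm_div, Complex.norm_ofNat, Complex.norm_real, Real.norm_eq_abs,
          abs_of_pos hm]
        nlinarith
      linarith
    · refine ((frequently_half_le_norm_add_exp hcn (by rw [hcre]; positivity) hα
        (β := β)).and_eventually (hlarge.and (hKsmall.and hCsmall))).mono ?_
      rintro t ⟨hf, ht, hs, hs'⟩
      have ht1 : 1 ≤ t := (le_max_right N 1).trans ht
      have ht0 : 0 < t := by linarith
      change _ ≤ ‖Y' t‖
      rw [hY'id t ht0]
      obtain ⟨h1, h2⟩ := hAB t ht
      have h3 : 1 / 4 ≤ ‖A t + B t‖ := by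
        have h4 := norm_le_norm_add_norm_sub' (α + Complex.exp (-(c * t)) * β) (A t + B t)
        have h5 : α + Complex.exp (-(c * t)) * β - (A t + B t) =
          -(B t - Complex.exp (-(c * t)) * β) - (A t - α) := by ring
        rw [h5] at h4
        have h6 := norm_sub_le (-(B t - Complex.exp (-(c * t)) * β)) (A t - α)
        rw [norm_neg] at h6
        linarith
      gcongr
      have h7 := norm_sub_norm_le ((m : ℂ) / 2 * (A t + B t))
        (m' / m ^ 2 * ((A t - B t) / (2 * Complex.I * κ t)))
      have h8 : m / 8 ≤ ‖(m : ℂ) / 2 * (A t + B t)‖ := by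
        rw [norm_mul, norm_div, Complex.norm_ofNat, Complex.norm_real, Real.norm_eq_abs,
          abs_of_pos hm]
        nlinarith
      have h9 := hcorr t ht
      have h10 : m / 16 / t ≤ m / 16 := div_le_self (by positivity) ht1
      linarith

/-- If `f` is `C²` on a half line, its one-sided derivative at the end point agrees with the
two-sided one as soon as one of `f'`, `f''` (two-sided) is nonzero there. -/
lemma derivWithin_Ici_eq_deriv {f : ℝ → ℂ} {a : ℝ} (hf : ContDiffOn ℝ 2 f (Set.Ici a))
    (h : deriv f a ≠ 0 ∨ deriv (deriv f) a ≠ 0) : derivWithin f (Set.Ici a) a = deriv f a := by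
  rcases h with h | h
  · exact (differentiableAt_of_deriv_ne_zero h).derivWithin
      (uniqueDiffOn_Ici a a Set.self_mem_Ici)
  · have h1 : Filter.Tendsto (deriv f) (nhdsWithin a (Set.Ioi a)) (nhds (deriv f a)) :=
      (differentiableAt_of_deriv_ne_zero h).continuousAt.tendsto.mono_left nhdsWithin_le_nhds
    have h2 : Filter.Tendsto (derivWithin f (Set.Ici a)) (nhdsWithin a (Set.Ioi a))
        (nhds (derivWithin f (Set.Ici a) a)) :=
      ((hf.continuousOn_derivWithin (uniqueDiffOn_Ici a) (by norm_num)) a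
        Set.self_mem_Ici).tendsto.mono_left (nhdsWithin_mono _ Set.Ioi_subset_Ici_self)
    refine tendsto_nhds_unique (h2.congr' ?_) h1
    filter_upwards [self_mem_nhdsWithin] with x hx
    exact derivWithin_of_mem_nhds (Ici_mem_nhds hx)

/-- The Liouville transform turns `y'' + (k² m⁴ - L/x²) y = 0` into a first-order system
for `Y = m y` and `P = Y' / m²`. -/
lemma hasDerivAt_liouville_s12 {y y' : ℝ → ℂ} {m m' : ℝ → ℝ} {m'' x L : ℝ} {k : ℂ}
    (hx : x ≠ 0) (hm0 : m x ≠ 0)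
    (hm : HasDerivAt m (m' x) x) (hm' : HasDerivAt m' m'' x) (hy : HasDerivAt y (y' x) x)
    (hy' : HasDerivAt y' (-((k ^ 2 * m x ^ 4 - L / x ^ 2) * y x)) x) :
    HasDerivAt (fun s => m s * y s)
      ((m x ^ 2 : ℝ) * ((m' x * y x + m x * y' x) / (m x) ^ 2)) x ∧
    HasDerivAt (fun s => (m' s * y s + m s * y' s) / (m s : ℂ) ^ 2)
      (-(k ^ 2 * (m x ^ 2 : ℝ) * (m x * y x)) +
        (L / (x ^ 2 * m x ^ 2) + m'' / m x ^ 3 - 2 * m' x ^ 2 / m x ^ 4 : ℝ) * (m x * y x)) x := by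
  have hmC : (m x : ℂ) ≠ 0 := by exact_mod_cast hm0
  have hxC : (x : ℂ) ≠ 0 := by exact_mod_cast hx
  have c1 := hm.ofReal_comp
  have c2 := hm'.ofReal_comp
  constructor
  · refine (c1.mul hy).congr_deriv ?_
    push_cast
    field_simp
  · refine (((c2.mul hy).add (c1.mul hy')).div (c1.pow 2) (pow_ne_zero 2 hmC)).congr_deriv ?_
    simp only [Pi.add_apply, Pi.mul_apply, Pi.pow_apply]
    push_cast
    field_simp
    ring

/-- Indicator of the extended solution (Lemma 3.8): for `r ≥ R` and `θ ∈ [0, 2π]`,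
the indicator functions of `k ↦ y(r;k)` and `k ↦ ∂_r y(r;k)` both equal `ξ(r)·|sin θ|`. -/
theorem indicator_extended_solution
    (R R₀ : ℝ) (hR : 0 < R) (hRR₀ : R < R₀)
    (n : ℝ → ℝ) (hn : ContDiffOn ℝ 2 n (Set.Ici 0))
    (hnpos : ∀ r ∈ Set.Ici (0:ℝ), 0 < n r)
    (hnin : ∀ r ∈ Set.Icc (0:ℝ) R, n r = 1) (hnout : ∀ r ∈ Set.Ici R₀, n r = 1)
    (ξ : ℝ → ℝ) (hξ : ∀ r : ℝ, ξ r = ∫ ρ in (0:ℝ)..r, Real.sqrt (n ρ))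
    (l : ℕ)
    (y : ℂ → ℝ → ℂ)
    (hy : ∀ k : ℂ, ContDiffOn ℝ 2 (y k) (Set.Ici R))
    (hode : ∀ k : ℂ, ∀ r ∈ Set.Ici R,
      deriv (deriv (y k)) r
        + (k ^ 2 * (n r : ℂ) - ((l * (l + 1) : ℕ) : ℂ) / (r : ℂ) ^ 2) * y k r = 0)
    (hinit : ∀ k : ℂ, y k R = (R : ℂ) * sphBessel l (k * R))
    (hinit' : ∀ k : ℂ, deriv (y k) R =
      sphBessel l (k * R) + (R : ℂ) * k * deriv (sphBessel l) (k * R)) :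
    ∀ r : ℝ, R ≤ r → ∀ θ ∈ Set.Icc (0:ℝ) (2 * π),
      indic (fun k => y k r) θ = ((ξ r * |Real.sin θ| : ℝ) : EReal) ∧
      indic (fun k => deriv (y k) r) θ = ((ξ r * |Real.sin θ| : ℝ) : EReal) := by
  have hm0 : ∀ x : ℝ, 0 < x → 0 < n x := fun x hx => hnpos x hx.le
  set m : ℝ → ℝ := fun x => n x ^ (1 / 4 : ℝ) with hm
  have hmpos : ∀ x : ℝ, 0 < x → 0 < m x := fun x hx => Real.rpow_pos_of_pos (hm0 x hx) _
  have hm4 : ∀ x : ℝ, 0 < x → m x ^ 4 = n x := fun x hx => by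
    simp only [hm]
    rw [← Real.rpow_natCast, ← Real.rpow_mul (hm0 x hx).le]
    norm_num
  have hm2 : ∀ x : ℝ, 0 < x → √(n x) = m x ^ 2 := fun x hx => by
    rw [← hm4 x hx, show m x ^ 4 = (m x ^ 2) ^ 2 by ring, Real.sqrt_sq (sq_nonneg _)]
  have hmC : ContDiffOn ℝ 2 m (Set.Ioi 0) := fun x hx =>
    (((hn.contDiffAt (Ici_mem_nhds hx)).rpow_const_of_ne (hm0 x hx).ne')).contDiffWithinAt
  have hm'C : ContDiffOn ℝ 1 (deriv m) (Set.Ioi 0) := hmC.deriv_of_isOpen isOpen_Ioi (by norm_num)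
  have hm''C : ContinuousOn (deriv (deriv m)) (Set.Ioi 0) :=
    hm'C.continuousOn_deriv_of_isOpen isOpen_Ioi (by norm_num)
  have hmd : ∀ x : ℝ, 0 < x → HasDerivAt m (deriv m x) x := fun x hx =>
    ((hmC.differentiableOn (by norm_num)).differentiableAt (Ioi_mem_nhds hx)).hasDerivAt
  have hm'd : ∀ x : ℝ, 0 < x → HasDerivAt (deriv m) (deriv (deriv m) x) x := fun x hx =>
    ((hm'C.differentiableOn (by norm_num)).differentiableAt (Ioi_mem_nhds hx)).hasDerivAt
  have hmin : ∀ x ∈ Set.Icc 0 R, m x = 1 := fun x hx => by simp [hm, hnin x hx]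
  have hmR : m R = 1 := hmin R ⟨hR.le, le_rfl⟩
  have hm'R : deriv m R = 0 := by
    have h1 : HasDerivWithinAt m 0 (Set.Icc 0 R) R :=
      (hasDerivWithinAt_const R (Set.Icc 0 R) (1 : ℝ)).congr hmin hmR
    exact ((uniqueDiffOn_Icc hR) R ⟨hR.le, le_rfl⟩).eq_deriv _ (hmd R hR).hasDerivWithinAt h1
  have hsqrt : ContinuousOn (fun x => √(n x)) (Set.Ici 0) := hn.continuousOn.sqrt
  have hint : ∀ x : ℝ, 0 < x → IntervalIntegrable (fun x => √(n x)) MeasureTheory.volume 0 x :=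
    fun x hx => (hsqrt.mono (by
      rw [Set.uIcc_of_le hx.le]
      exact Set.Icc_subset_Ici_self)).intervalIntegrable
  have hξd : ∀ x : ℝ, 0 < x → HasDerivAt ξ (m x ^ 2) x := fun x hx => by
    rw [← hm2 x hx, funext hξ]
    refine intervalIntegral.integral_hasDerivAt_right (hint x hx) ?_
      (hsqrt.continuousAt (Ici_mem_nhds hx))
    exact (hsqrt.mono Set.Ioi_subset_Ici_self).stronglyMeasurableAtFilter isOpen_Ioi x hx
  have hξpos : ∀ x : ℝ, 0 < x → 0 < ξ x := fun x hx => by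
    rw [hξ]
    exact intervalIntegral.intervalIntegral_pos_of_pos_on (hint x hx)
      (fun t ht => Real.sqrt_pos.2 (hm0 t ht.1)) hx
  have hξR : ξ R = R := by
    rw [hξ, intervalIntegral.integral_congr (g := fun _ => (1 : ℝ))]
    · simp
    · intro x hx
      rw [Set.uIcc_of_le hR.le] at hx
      simp [hnin x hx]
  intro r hr θ _
  have hr0 : 0 < r := hR.trans_le hr
  obtain ⟨ε, hε, hsin⟩ : ∃ ε : ℝ, (ε = 1 ∨ ε = -1) ∧ ε * Real.sin θ = -|Real.sin θ| := by
    rcases abs_choice (Real.sin θ) with h | h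
    · exact ⟨-1, Or.inr rfl, by rw [h]; ring⟩
    · exact ⟨1, Or.inl rfl, by rw [h]; ring⟩
  have hεn : ‖(ε : ℂ)‖ = 1 := by rcases hε with rfl | rfl <;> simp
  have hε2 : (ε : ℂ) ^ 2 = 1 := by rcases hε with rfl | rfl <;> simp
  obtain ⟨α, β, hα, hβ, K, hK, hbes⟩ := sphBessel_asymptotics l ε hε
  set L : ℝ := ((l * (l + 1) : ℕ) : ℝ) with hL
  have hL0 : 0 ≤ L := Nat.cast_nonneg _
  set g : ℝ → ℝ := fun x => L / (x ^ 2 * m x ^ 2) + deriv (deriv m) x / m x ^ 3 -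
    2 * deriv m x ^ 2 / m x ^ 4 with hg
  have hIcc : Set.Icc R r ⊆ Set.Ioi 0 := fun x hx => hR.trans_le hx.1
  have hmc : ContinuousOn m (Set.Icc R r) := hmC.continuousOn.mono hIcc
  have hm'c : ContinuousOn (deriv m) (Set.Icc R r) := hm'C.continuousOn.mono hIcc
  have hm''c : ContinuousOn (deriv (deriv m)) (Set.Icc R r) := hm''C.mono hIcc
  have hξc : ContinuousOn ξ (Set.Icc R r) := fun x hx =>
    (hξd x (hIcc hx)).continuousAt.continuousWithinAt
  have hne : ∀ x ∈ Set.Icc R r, m x ≠ 0 := fun x hx => (hmpos x (hIcc hx)).ne'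
  have hxne : ∀ x ∈ Set.Icc R r, x ≠ 0 := fun x hx => (hIcc hx).ne'
  have hgc : ContinuousOn g (Set.Icc R r) := by
    refine ((continuousOn_const.div (by fun_prop) fun x hx => ?_).add
      (hm''c.div (hmc.pow 3) fun x hx => pow_ne_zero 3 (hne x hx))).sub
      ((by fun_prop : ContinuousOn (fun x => 2 * deriv m x ^ 2) (Set.Icc R r)).div (hmc.pow 4)
        fun x hx => pow_ne_zero 4 (hne x hx))
    exact mul_ne_zero (pow_ne_zero 2 (hxne x hx)) (pow_ne_zero 2 (hne x hx))
  obtain ⟨G, hG⟩ := isCompact_Icc.exists_bound_of_continuousOn hgc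
  have hG0 : 0 ≤ G := (norm_nonneg _).trans (hG R ⟨le_rfl, hr⟩)
  refine indic_eq_of_wkb (m := m r) (m' := deriv m r) (N := 1 + (1 + K + L) / R)
    (K := √((2 * (K / R) ^ 2 + 1) * Real.exp (4 * G * (r - R)))) hε hsin (hξpos r hr0)
    (hmpos r hr0) (Real.sqrt_nonneg _) hα hβ fun k hk him => ?_
  have hk1 : 1 ≤ ‖k‖ := by
    have : 0 ≤ (1 + K + L) / R := by positivity
    linarith
  have hz : 1 + K + L ≤ ‖k * R‖ := by
    rw [norm_mul, Complex.norm_real, Real.norm_eq_abs, abs_of_pos hR, ← div_le_iff₀ hR]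
    linarith
  have hzpos : 0 < ‖k * R‖ := by linarith
  have hzim : (ε * (k * R)).im ≤ 0 := by
    rw [← mul_assoc, Complex.im_mul_ofReal]
    exact mul_nonpos_of_nonpos_of_nonneg him hR.le
  obtain ⟨hb1, hb2⟩ := hbes (k * R) (by linarith) hzim
  have hKR : K / ‖k * R‖ = K / R / ‖(ε : ℂ) * k‖ := by
    rw [norm_mul, norm_mul, hεn, Complex.norm_real, Real.norm_eq_abs, abs_of_pos hR, one_mul,
      div_div, mul_comm]
  have hyd : deriv (y k) R = sphBessel l (k * R) + k * R * deriv (sphBessel l) (k * R) := by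
    rw [hinit']; ring
  have hyv : k * R * sphBessel l (k * R) = k * y k R := by
    rw [hinit]; ring
  rw [hyv, ← hyd] at hb1 hb2
  have hderiv : derivWithin (y k) (Set.Ici R) R = deriv (y k) R := by
    refine derivWithin_Ici_eq_deriv (hy k) ?_
    by_contra! hcon
    obtain ⟨h1, h2⟩ := hcon
    have h3 := hode k R Set.self_mem_Ici
    rw [h2, zero_add, hnin R ⟨hR.le, le_rfl⟩] at h3
    rcases mul_eq_zero.1 h3 with h4 | h4
    · have h5 : (k * R) ^ 2 = ((l * (l + 1) : ℕ) : ℂ) := by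
        have : (R : ℂ) ≠ 0 := by exact_mod_cast hR.ne'
        field_simp at h4
        push_cast at h4 ⊢
        linear_combination h4
      have h6 : ‖k * R‖ ^ 2 = L := by
        rw [← norm_pow, h5, Complex.norm_natCast]
      nlinarith
    · rw [h1, h4] at hb1
      simp only [mul_zero, add_zero, zero_sub, norm_neg, hα] at hb1
      rw [le_div_iff₀ hzpos] at hb1
      linarith
  set dy : ℝ → ℂ := derivWithin (y k) (Set.Ici R) with hdy
  have hdyeq : ∀ x : ℝ, R < x → dy x = deriv (y k) x := fun x hx =>
    derivWithin_of_mem_nhds (Ici_mem_nhds hx)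
  have hdyr : deriv (y k) r = dy r := by
    rcases hr.eq_or_lt with rfl | h
    · exact hderiv.symm
    · exact (hdyeq r h).symm
  have hyc : ContinuousOn (y k) (Set.Icc R r) :=
    (hy k).continuousOn.mono Set.Icc_subset_Ici_self
  have hdyc : ContinuousOn dy (Set.Icc R r) :=
    ((hy k).continuousOn_derivWithin (uniqueDiffOn_Ici R) (by norm_num)).mono
      Set.Icc_subset_Ici_self
  have hyd1 : ∀ x : ℝ, R < x → HasDerivAt (y k) (dy x) x := fun x hx => by
    rw [hdyeq x hx]
    exact (((hy k).differentiableOn (by norm_num)).differentiableAt (Ici_mem_nhds hx)).hasDerivAt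
  have hyd2 : ∀ x : ℝ, R < x →
      HasDerivAt dy (-((k ^ 2 * m x ^ 4 - L / x ^ 2) * y k x)) x := fun x hx => by
    have h1 : HasDerivAt (deriv (y k)) (deriv (deriv (y k)) x) x := by
      have : ContDiffOn ℝ 1 (deriv (y k)) (Set.Ioi R) :=
        ((hy k).mono Set.Ioi_subset_Ici_self).deriv_of_isOpen isOpen_Ioi (by norm_num)
      exact ((this.differentiableOn (by norm_num)).differentiableAt (Ioi_mem_nhds hx)).hasDerivAt
    have h2 := h1.congr_of_eventuallyEq
      (f₁ := dy) ((eventually_gt_nhds hx).mono fun s hs => hdyeq s hs)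
    refine h2.congr_deriv ?_
    have h3 := hode k x hx.le
    have h4 : ((m x : ℂ)) ^ 4 = n x := by exact_mod_cast hm4 x (hR.trans hx)
    rw [h4, hL, Complex.ofReal_natCast]
    linear_combination h3
  have hliou : ∀ x : ℝ, R < x → _ := fun x hx =>
    hasDerivAt_liouville_s12 (k := k) (L := L) (hR.trans hx).ne' (hmpos x (hR.trans hx)).ne'
      (hmd x (hR.trans hx)) (hm'd x (hR.trans hx)) (hyd1 x hx) (hyd2 x hx)
  have hmcC : ContinuousOn (fun x => (m x : ℂ)) (Set.Icc R r) :=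
    Complex.continuous_ofReal.comp_continuousOn hmc
  have hm'cC : ContinuousOn (fun x => ((deriv m x : ℝ) : ℂ)) (Set.Icc R r) :=
    Complex.continuous_ofReal.comp_continuousOn hm'c
  have hκn : ‖(ε : ℂ) * k‖ = ‖k‖ := by rw [norm_mul, hεn, one_mul]
  have hwkb := wkb_estimate (κ := ε * k) (Y := fun s => m s * y k s)
    (P := fun s => (((deriv m s : ℝ) : ℂ) * y k s + m s * dy s) / (m s : ℂ) ^ 2) (σ := fun s => m s ^ 2)
    (g := g) (ξ := ξ) (K := K / R) (α := α) (β := β) hr (by rw [hκn]; exact hk1) him hG0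
    (hmcC.mul hyc)
    (((hm'cC.mul hyc).add (hmcC.mul hdyc)).div (hmcC.pow 2)
      fun x hx => pow_ne_zero 2 (Complex.ofReal_ne_zero.2 (hne x hx))) hξc
    (fun x hx => (hliou x hx.1).1)
    (fun x hx => (hliou x hx.1).2.congr_deriv (by rw [mul_pow, hε2, one_mul]))
    (fun x hx => hξd x (hR.trans hx.1)) (fun x _ => sq_nonneg _)
    (fun x hx => hG x ⟨hx.1.le, hx.2.le⟩) (fun x hx => (hξpos x (hR.trans hx.1)).le) hα hβ
    (by
      rw [← hKR]
      refine le_of_eq_of_le ?_ hb1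
      simp only [hξR, hmR, hm'R, hderiv]
      push_cast
      ring_nf)
    (by
      rw [← hKR]
      refine le_of_eq_of_le ?_ hb2
      simp only [hξR, hmR, hm'R, hderiv]
      push_cast
      ring_nf)
  rw [hκn] at hwkb
  rw [hdyr]
  exact hwkb
end
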